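/- arXiv:2306.08065 — 2 statements merged into one kernel-verified Lean document; each statement's English description precedes it below -/
import Mathlib

section
/- The patterns 2413 and 2314 are (Desbot, Asctop, Ascbot, Val, LRmin)-Wilf equivalent: for every n ≥ 0 and all sets B, A_t, A_b, V, L ⊆ [n], the number of permutations σ ∈ Av_n(2413) with Desbot(σ) = B, Asctop(σ) = A_t, Ascbot(σ) = A_b, Val(σ) = V, and LRmin(σ) = L equals the number of permutations σ ∈ Av_n(2314) with the same five set values. -/
open scoped Classical

/-- The 1-based `i`-th entry of a permutation `σ` of `{1,…,n}`, as a value in `{1,…,n}`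
(one-line notation `σ(1)…σ(n)`). -/
def entry {n : ℕ} (σ : Equiv.Perm (Fin n)) (i : ℕ) : ℕ :=
  if h : i - 1 < n then (σ ⟨i - 1, h⟩ : ℕ) + 1 else 0

/-- `σ` contains the pattern `π ∈ S_k` (given in 0-based one-line notation as a function):
there is a (not necessarily consecutive) subsequence of `σ` order-isomorphic to `π`. -/
def Contains {n k : ℕ} (π : Fin k → Fin k) (σ : Equiv.Perm (Fin n)) : Prop :=
  ∃ f : Fin k → Fin n, StrictMono f ∧ ∀ i j : Fin k, π i < π j ↔ σ (f i) < σ (f j)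

/-- `σ` avoids the pattern `π`. -/
def AvoidsPat {n k : ℕ} (π : Fin k → Fin k) (σ : Equiv.Perm (Fin n)) : Prop :=
  ¬ Contains π σ

/-- The descent set of `σ` (1-based positions `i ∈ [n-1]` with `σ(i) > σ(i+1)`). -/
def Des {n : ℕ} (σ : Equiv.Perm (Fin n)) : Finset ℕ :=
  (Finset.Icc 1 (n - 1)).filter (fun i => entry σ (i + 1) < entry σ i)

/-- The descent top set of `σ`: `{σ(i) : i ∈ Des σ}`. -/
def Destop {n : ℕ} (σ : Equiv.Perm (Fin n)) : Finset ℕ :=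
  (Des σ).image (entry σ)

/-- The descent bottom set of `σ`: `{σ(i+1) : i ∈ Des σ}`. -/
def Desbot {n : ℕ} (σ : Equiv.Perm (Fin n)) : Finset ℕ :=
  (Des σ).image (fun i => entry σ (i + 1))

/-- The ascent set of `σ` (1-based positions `i ∈ [n-1]` with `σ(i) < σ(i+1)`). -/
def Asc {n : ℕ} (σ : Equiv.Perm (Fin n)) : Finset ℕ :=
  (Finset.Icc 1 (n - 1)).filter (fun i => entry σ i < entry σ (i + 1))

/-- The ascent top set of `σ`: `{σ(i+1) : i ∈ Asc σ}`. -/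
def Asctop {n : ℕ} (σ : Equiv.Perm (Fin n)) : Finset ℕ :=
  (Asc σ).image (fun i => entry σ (i + 1))

/-- The ascent bottom set of `σ`: `{σ(i) : i ∈ Asc σ}`. -/
def Ascbot {n : ℕ} (σ : Equiv.Perm (Fin n)) : Finset ℕ :=
  (Asc σ).image (entry σ)

/-- The set of peak values of `σ`. -/
def Peak {n : ℕ} (σ : Equiv.Perm (Fin n)) : Finset ℕ :=
  Destop σ ∩ Asctop σ

/-- The set of valley values of `σ`. -/
def Val {n : ℕ} (σ : Equiv.Perm (Fin n)) : Finset ℕ :=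
  Desbot σ ∩ Ascbot σ

/-- The set of left-to-right maxima (as values) of `σ`. -/
noncomputable def LRmax {n : ℕ} (σ : Equiv.Perm (Fin n)) : Finset ℕ :=
  ((Finset.Icc 1 n).filter (fun i => ∀ j, 1 ≤ j → j < i → entry σ j < entry σ i)).image (entry σ)

/-- The set of left-to-right minima (as values) of `σ`. -/
noncomputable def LRmin {n : ℕ} (σ : Equiv.Perm (Fin n)) : Finset ℕ :=
  ((Finset.Icc 1 n).filter (fun i => ∀ j, 1 ≤ j → j < i → entry σ i < entry σ j)).image (entry σ)

/-- The set of right-to-left maxima (as values) of `σ`. -/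
noncomputable def RLmax {n : ℕ} (σ : Equiv.Perm (Fin n)) : Finset ℕ :=
  ((Finset.Icc 1 n).filter (fun i => ∀ j, i < j → j ≤ n → entry σ j < entry σ i)).image (entry σ)

/-- The set of right-to-left minima (as values) of `σ`. -/
noncomputable def RLmin {n : ℕ} (σ : Equiv.Perm (Fin n)) : Finset ℕ :=
  ((Finset.Icc 1 n).filter (fun i => ∀ j, i < j → j ≤ n → entry σ i < entry σ j)).image (entry σ)

/-- `(T, B)` is a descent matching: `T` and `B` are finite sets of positive integers
with `|T| = |B| = k`, and writing `T = {t_1 < … < t_k}`, `B = {b_1 < … < b_k}`,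
we have `t_i > b_i` for all `i ∈ [k]`. -/
def DescentMatching (T B : Finset ℕ) : Prop :=
  T.card = B.card ∧ (∀ t ∈ T, 0 < t) ∧ (∀ b ∈ B, 0 < b) ∧
    ∀ i < T.card, (B.sort (· ≤ ·)).getD i 0 < (T.sort (· ≤ ·)).getD i 0

/-- `(2_v 31)σ`: the number of occurrences of the vincular pattern `2-31` in `σ`
in which the "2" has value `v`. -/
def occ2_31at {n : ℕ} (σ : Equiv.Perm (Fin n)) (v : ℕ) : ℕ :=
  ((Finset.Icc 1 (n - 1) ×ˢ Finset.Icc 1 (n - 1)).filter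
    (fun p => p.1 < p.2 ∧ entry σ (p.2 + 1) < entry σ p.2 ∧
      entry σ (p.2 + 1) < entry σ p.1 ∧ entry σ p.1 = v ∧ v < entry σ p.2)).card

/-- `(31 2_v)σ`: the number of occurrences of the vincular pattern `31-2` in `σ`
in which the "2" has value `v`. -/
def occ31_2at {n : ℕ} (σ : Equiv.Perm (Fin n)) (v : ℕ) : ℕ :=
  ((Finset.Icc 1 (n - 1) ×ˢ Finset.Icc 1 n).filter
    (fun p => p.1 + 1 < p.2 ∧ entry σ (p.1 + 1) < entry σ p.1 ∧
      entry σ (p.1 + 1) < entry σ p.2 ∧ entry σ p.2 = v ∧ v < entry σ p.1)).card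

/-- `(2-31)σ`: the number of occurrences of the vincular pattern `2-31` in `σ`. -/
def occ2_31 {n : ℕ} (σ : Equiv.Perm (Fin n)) : ℕ :=
  ((Finset.Icc 1 (n - 1) ×ˢ Finset.Icc 1 (n - 1)).filter
    (fun p => p.1 < p.2 ∧ entry σ (p.2 + 1) < entry σ p.2 ∧
      entry σ (p.2 + 1) < entry σ p.1 ∧ entry σ p.1 < entry σ p.2)).card

/-- `(31-2)σ`: the number of occurrences of the vincular pattern `31-2` in `σ`. -/
def occ31_2 {n : ℕ} (σ : Equiv.Perm (Fin n)) : ℕ :=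
  ((Finset.Icc 1 (n - 1) ×ˢ Finset.Icc 1 n).filter
    (fun p => p.1 + 1 < p.2 ∧ entry σ (p.1 + 1) < entry σ p.1 ∧
      entry σ (p.1 + 1) < entry σ p.2 ∧ entry σ p.2 < entry σ p.1)).card

/-- The signature function `sg_{(T,B)}(i) = |B_{<i}| - |T_{≤i}| + 1`. -/
def sg (T B : Finset ℕ) (i : ℕ) : ℕ :=
  (B.filter (fun b => b < i)).card - (T.filter (fun t => t ≤ i)).card + 1

/-- The `(p,q)`-integer `[m]_{p,q} = Σ_{a+b=m-1} p^a q^b`. -/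
def genQInt {R : Type*} [CommRing R] (m : ℕ) (p q : R) : R :=
  ∑ a ∈ Finset.range m, p ^ a * q ^ (m - 1 - a)

/-- The reverse complement of `σ`: `σ^{rc}(i) = n + 1 - σ(n + 1 - i)`. -/
def revComp {n : ℕ} (σ : Equiv.Perm (Fin n)) : Equiv.Perm (Fin n) :=
  (Fin.revPerm.trans σ).trans Fin.revPerm

namespace WilfProof

/-- Optional marker. -/
def mk (N : ℕ) (b : Bool) : List ℕ := if b then [N] else []

/-- Insert `v` in the gap between `P` and `Q`. -/
def ch (N v : ℕ) (P Q : List ℕ) (l r : Bool) : List ℕ :=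
  P ++ mk N l ++ v :: (mk N r ++ Q)

def Word (N k : ℕ) (u : List ℕ) : Prop :=
  (∃ t, u = N :: t) ∧ u.IsChain (fun a b => ¬ (a = N ∧ b = N)) ∧
    u.Pairwise (fun a b => a = b → a = N) ∧
    ∀ x, x ∈ u ↔ x = N ∨ (1 ≤ x ∧ x ≤ k)

def G1 (u : List ℕ) : Prop :=
  ∀ a b c d, [b, c, a, d].Sublist u → ¬ (a < b ∧ b < d ∧ d < c)

def G2 (u : List ℕ) : Prop :=
  ∀ a b c d, [b, c, a, d].Sublist u → ¬ (a < b ∧ b < c ∧ c < d)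

def A1 (N : ℕ) (P : List ℕ) : Prop :=
  ∀ X Y, P = X ++ N :: Y → ∀ b ∈ X, ∀ a ∈ Y, b < N → a < N → b < a

def A2 (N : ℕ) (P Q : List ℕ) : Prop :=
  ∀ X Y, Q = X ++ N :: Y → ∀ b ∈ P, ∀ a ∈ X, b < N → a < N → b < a

noncomputable def J1 (N : ℕ) (P Q : List ℕ) : ℕ :=
  P.count N + (Q.dropWhile (fun x => decide (∀ y ∈ P, y < N → y < x))).count N

def J2 (N : ℕ) (P : List ℕ) : ℕ := P.count N

def S1 (N : ℕ) (u : List ℕ) (x : ℕ) : Prop :=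
  ∃ P Q, u = P ++ N :: Q ∧ A1 N P ∧ x = J1 N P Q

def S2 (N : ℕ) (u : List ℕ) (x : ℕ) : Prop :=
  ∃ P Q, u = P ++ N :: Q ∧ A2 N P Q ∧ x = J2 N P

/-- The information on a split that we use. -/
structure Ctx (N v : ℕ) (P Q : List ℕ) : Prop where
  vN : v < N
  hP : ∀ x ∈ P, x = N ∨ x < v
  hQ : ∀ x ∈ Q, x = N ∨ x < v
  hP0 : P = [] ∨ ∃ t, P = N :: t
  hPl : ∀ x ∈ P.getLast?, x ≠ N
  hQh : ∀ x ∈ Q.head?, x ≠ N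
  chP : P.IsChain (fun a b => ¬ (a = N ∧ b = N))
  chQ : Q.IsChain (fun a b => ¬ (a = N ∧ b = N))
  nd : (P ++ N :: Q).Pairwise (fun a b => a = b → a = N)

theorem Word.ctx {N k : ℕ} {P Q : List ℕ} (h : Word N k (P ++ N :: Q)) (hk : k + 1 < N) :
    Ctx N (k+1) P Q := by
  obtain ⟨⟨t, ht⟩, hc, hp, hm⟩ := h
  have hc' := hc
  simp only [List.isChain_append, List.isChain_cons, List.head?_cons, Option.mem_def,
    Option.some.injEq] at hc
  refine ⟨hk, ?_, ?_, ?_, ?_, ?_, hc.1, hc.2.1.2, hp⟩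
  · intro x hx
    have := (hm x).1 (by simp [hx])
    omega
  · intro x hx
    have := (hm x).1 (by simp [hx])
    omega
  · rw [List.append_eq_cons_iff] at ht
    rcases ht with h | ⟨a, h, _⟩
    · exact Or.inl h.1
    · exact Or.inr ⟨a, h⟩
  · intro x hx h
    exact hc.2.2 x hx N (by simp) ⟨h, by simp⟩
  · intro x hx h
    exact hc.2.1.1 x hx ⟨by simp, h⟩

theorem word_child {N k : ℕ} {P Q : List ℕ} {l r : Bool} (h : Word N k (P ++ N :: Q))
    (hk : k + 1 < N) (hl : P = [] → l = true) : Word N (k+1) (ch N (k+1) P Q l r) := by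
  have c := h.ctx hk
  obtain ⟨⟨t, ht⟩, hc, hp, hm⟩ := h
  have hP := c.hP
  have hQ := c.hQ
  refine ⟨?_, ?_, ?_, ?_⟩
  · rcases c.hP0 with h0 | ⟨t, h0⟩
    · simp [ch, mk, h0, hl h0]
    · simp [ch, h0]
  · have h1 := c.chP
    have h2 := c.chQ
    have h3 := c.hPl
    have h4 := c.hQh
    have : k + 1 ≠ N := by omega
    cases l <;> cases r <;>
      simp [ch, mk, List.isChain_append, List.isChain_cons] at * <;> grind
  · have : k + 1 ≠ N := by omega
    cases l <;> cases r <;>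
      simp [ch, mk, List.pairwise_append] at * <;> grind
  · intro x
    have hx := hm x
    have hN : N ∈ P ∨ l = true := by
      rcases c.hP0 with h0 | ⟨t, h0⟩
      · exact Or.inr (hl h0)
      · simp [h0]
    clear hp hc c ht hl hm
    have hP := hP x
    have hQ := hQ x
    cases l <;> cases r <;>
      simp [ch, mk] at * <;> grind

theorem word_decomp {N k : ℕ} {u : List ℕ} (h : Word N (k+1) u) (hk : k + 1 < N) :
    ∃ P Q l r, u = ch N (k+1) P Q l r ∧ Word N k (P ++ N :: Q) ∧ (P = [] → l = true) := by
  obtain ⟨⟨t, ht⟩, hc, hp, hm⟩ := h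
  have hv : k + 1 ∈ u := (hm _).2 (by omega)
  obtain ⟨X, Y, rfl⟩ := List.append_of_mem hv
  have hX : ∃ P l, X = P ++ mk N l ∧ (P = [] → l = true) ∧ (∀ x ∈ P.getLast?, x ≠ N) := by
    rcases List.eq_nil_or_concat' X with h0 | ⟨Z, z, h0⟩
    · subst h0
      simp at ht; omega
    · by_cases hz : z = N
      · refine ⟨Z, true, by simp [mk, h0, hz], by simp, ?_⟩
        subst h0 hz
        simp [List.isChain_append, List.isChain_cons] at hc
        grind
      · exact ⟨X, false, by simp [mk], by simp [h0], by simp [h0, hz]⟩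
  have hY : ∃ Q r, Y = mk N r ++ Q ∧ (∀ x ∈ Q.head?, x ≠ N) := by
    rcases Y with _ | ⟨z, Z⟩
    · exact ⟨[], false, by simp [mk], by simp⟩
    · by_cases hz : z = N
      · refine ⟨Z, true, by simp [mk, hz], ?_⟩
        subst hz
        simp [List.isChain_append, List.isChain_cons] at hc
        intro x hx
        exact hc.2.1.2.1 x hx
      · exact ⟨z :: Z, false, by simp [mk], by simp [hz]⟩
  obtain ⟨P, l, rfl, hl, hPl⟩ := hX
  obtain ⟨Q, r, rfl, hQh⟩ := hY
  refine ⟨P, Q, l, r, rfl, ⟨?_, ?_, ?_, ?_⟩, hl⟩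
  · rcases P with _ | ⟨z, Z⟩
    · simp
    · simp at ht ⊢
      exact ht.1
  · cases l <;> cases r <;>
      simp [mk, List.isChain_append, List.isChain_cons] at * <;> grind
  · cases l <;> cases r <;>
      simp [mk, List.pairwise_append] at * <;> grind
  · intro x
    have := hm x
    have h2 : x ∈ P → x ≠ k + 1 := by
      rintro hx rfl
      cases l <;> cases r <;>
      simp [mk, List.pairwise_append] at * <;> grind
    have h3 : x ∈ Q → x ≠ k + 1 := by
      rintro hx rfl
      cases l <;> cases r <;>
      simp [mk, List.pairwise_append] at * <;> grind
    cases l <;> cases r <;>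
      simp [mk] at * <;> grind

theorem append_v_inj {v : ℕ} {A B A' B' : List ℕ} (h : A ++ v :: B = A' ++ v :: B')
    (h1 : v ∉ A) (h2 : v ∉ A') : A = A' ∧ B = B' := by
  induction A generalizing A' with
  | nil =>
    cases A' with
    | nil => simpa using h
    | cons a A' => simp at h h2; omega
  | cons a A ih =>
    cases A' with
    | nil => simp at h h1; omega
    | cons a' A' =>
      simp at h h1 h2
      have := ih h.2 h1.2 h2.2
      simp [h.1, this]

theorem ch_inj {N v : ℕ} {P Q P' Q' : List ℕ} {l r l' r' : Bool}
    (c : Ctx N v P Q) (c' : Ctx N v P' Q') (h : ch N v P Q l r = ch N v P' Q' l' r') :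
    P = P' ∧ Q = Q' ∧ l = l' ∧ r = r' := by
  have hv := c.vN
  have := append_v_inj h (by
    have := c.hP v; cases l <;> simp [mk] <;> grind) (by
    have := c'.hP v; cases l' <;> simp [mk] <;> grind)
  obtain ⟨h1, h2⟩ := this
  have e1 := c.hPl
  have e2 := c'.hPl
  have e3 := c.hQh
  have e4 := c'.hQh
  have : P = P' ∧ l = l' := by
    cases l <;> cases l' <;> simp [mk] at h1 ⊢ <;> first | exact h1 | (subst h1; simp at e1 e2)
  have : Q = Q' ∧ r = r' := by
    cases r <;> cases r' <;> simp [mk] at h2 ⊢ <;> first | exact h2 | (subst h2; simp at e3 e4)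
  tauto

theorem count_ch {N v : ℕ} {P Q : List ℕ} {l r : Bool} (hv : v < N) :
    (ch N v P Q l r).count N = P.count N + l.toNat + r.toNat + Q.count N := by
  have : v ≠ N := by omega
  cases l <;> cases r <;> simp [ch, mk, this] <;> omega

theorem sub3_iff {a b c : ℕ} {P : List ℕ} :
    [b, c, a].Sublist P ↔ ∃ X Y, P = X ++ c :: Y ∧ b ∈ X ∧ a ∈ Y := by
  constructor
  · intro h
    rw [List.cons_sublist_iff] at h
    obtain ⟨r1, r2, rfl, hb, h⟩ := h
    have hc : c ∈ r2 := h.subset (by simp)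
    rw [List.cons_sublist_iff] at h
    obtain ⟨r3, r4, rfl, hc, h⟩ := h
    obtain ⟨s, t, rfl⟩ := List.append_of_mem hc
    exact ⟨r1 ++ s, t ++ r4, by simp, by simp [hb], by simp at h; simp [h]⟩
  · rintro ⟨X, Y, rfl, hb, ha⟩
    have h1 : [b].Sublist X := by simpa using hb
    have h2 : [a].Sublist Y := by simpa using ha
    exact h1.append (h2.cons_cons c)

theorem A1_iff {N : ℕ} {P : List ℕ} :
    A1 N P ↔ ∀ a b, [b, N, a].Sublist P → b < N → a < N → b < a := by
  constructor
  · intro h a b hs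
    obtain ⟨X, Y, h0, hb, ha⟩ := sub3_iff.1 hs
    exact h X Y h0 b hb a ha
  · intro h X Y h0 b hb a ha
    exact h a b (sub3_iff.2 ⟨X, Y, h0, hb, ha⟩)

theorem sub2_iff {a b : ℕ} {P : List ℕ} :
    [a, b].Sublist P ↔ ∃ X Y, P = X ++ b :: Y ∧ a ∈ X := by
  constructor
  · intro h
    rw [List.cons_sublist_iff] at h
    obtain ⟨r1, r2, rfl, hb, h⟩ := h
    simp at h
    obtain ⟨s, t, rfl⟩ := List.append_of_mem h
    exact ⟨r1 ++ s, t, by simp, by simp [hb]⟩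
  · rintro ⟨X, Y, rfl, hb⟩
    have h1 : [a].Sublist X := by simpa using hb
    exact h1.append (by simp)

theorem A2_iff {N : ℕ} {P Q : List ℕ} :
    A2 N P Q ↔ ∀ a b, b ∈ P → [a, N].Sublist Q → b < N → a < N → b < a := by
  constructor
  · intro h a b hs h2
    obtain ⟨X, Y, h0, ha⟩ := sub2_iff.1 h2
    exact h X Y h0 b hs a ha
  · intro h X Y h0 b hb a ha
    exact h a b hb (sub2_iff.2 ⟨X, Y, h0, ha⟩)

/-- Sublists of an append, case by case. -/
theorem sub_app4 {b c a d : ℕ} {A B : List ℕ} :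
    [b, c, a, d].Sublist (A ++ B) ↔ [b, c, a, d].Sublist A ∨
      ([b, c, a].Sublist A ∧ d ∈ B) ∨ ([b, c].Sublist A ∧ [a, d].Sublist B) ∨
      (b ∈ A ∧ [c, a, d].Sublist B) ∨ [b, c, a, d].Sublist B := by
  rw [List.sublist_append_iff]
  constructor
  · rintro ⟨l1, l2, h, h1, h2⟩
    rcases l1 with _ | ⟨x, _ | ⟨y, _ | ⟨z, _ | ⟨w, l1⟩⟩⟩⟩ <;> simp at h
    · subst h; tauto
    · obtain ⟨rfl, rfl⟩ := h; simp at h1; tauto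
    · obtain ⟨rfl, rfl, rfl⟩ := h; tauto
    · obtain ⟨rfl, rfl, rfl, rfl⟩ := h; simp at h2; tauto
    · obtain ⟨rfl, rfl, rfl, rfl, rfl, rfl⟩ := h; tauto
  · rintro (h | ⟨h, h'⟩ | ⟨h, h'⟩ | ⟨h, h'⟩ | h)
    · exact ⟨_, [], by simp, h, by simp⟩
    · exact ⟨_, [d], by simp, h, by simpa⟩
    · exact ⟨_, _, by simp, h, h'⟩
    · exact ⟨[b], _, by simp, by simpa, h'⟩
    · exact ⟨[], _, by simp, by simp, h⟩

theorem sub_app3 {c a d : ℕ} {A B : List ℕ} :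
    [c, a, d].Sublist (A ++ B) ↔ 
      [c, a, d].Sublist A ∨ ([c, a].Sublist A ∧ d ∈ B) ∨
      (c ∈ A ∧ [a, d].Sublist B) ∨ [c, a, d].Sublist B := by
  rw [List.sublist_append_iff]
  constructor
  · rintro ⟨l1, l2, h, h1, h2⟩
    rcases l1 with _ | ⟨x, _ | ⟨y, _ | ⟨z, l1⟩⟩⟩ <;> simp at h
    · subst h; tauto
    · obtain ⟨rfl, rfl⟩ := h; simp at h1; tauto
    · obtain ⟨rfl, rfl, rfl⟩ := h; simp at h2; tauto
    · obtain ⟨rfl, rfl, rfl, rfl, rfl⟩ := h; tauto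
  · rintro (h | ⟨h, h'⟩ | ⟨h, h'⟩ | h)
    · exact ⟨_, [], by simp, h, by simp⟩
    · exact ⟨_, [d], by simp, h, by simpa⟩
    · exact ⟨[c], _, by simp, by simpa, h'⟩
    · exact ⟨[], _, by simp, by simp, h⟩

theorem sub_app2 {a d : ℕ} {A B : List ℕ} :
    [a, d].Sublist (A ++ B) ↔ 
      [a, d].Sublist A ∨ (a ∈ A ∧ d ∈ B) ∨ [a, d].Sublist B := by
  rw [List.sublist_append_iff]
  constructor
  · rintro ⟨l1, l2, h, h1, h2⟩
    rcases l1 with _ | ⟨x, _ | ⟨y, l1⟩⟩ <;> simp at h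
    · subst h; tauto
    · obtain ⟨rfl, rfl⟩ := h; simp at h1 h2; tauto
    · obtain ⟨rfl, rfl, rfl, rfl⟩ := h; tauto
  · rintro (h | ⟨h, h'⟩ | h)
    · exact ⟨_, [], by simp, h, by simp⟩
    · exact ⟨[a], [d], by simp, by simpa, by simpa⟩
    · exact ⟨[], _, by simp, by simp, h⟩

/-- Splitting a pattern over `P ++ M ++ Q`, when nothing but one entry can lie in `M`. -/
theorem sub_cons4 {b c a d x : ℕ} {B : List ℕ} :
    [b, c, a, d].Sublist (x :: B) ↔ (b = x ∧ [c, a, d].Sublist B) ∨ [b, c, a, d].Sublist B := by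
  rw [List.sublist_cons_iff]
  constructor
  · rintro (h | ⟨r, h, h'⟩)
    · tauto
    · simp at h; obtain ⟨rfl, rfl⟩ := h; tauto
  · rintro (⟨rfl, h⟩ | h)
    · exact Or.inr ⟨_, rfl, h⟩
    · tauto

theorem sub_cons3 {c a d x : ℕ} {B : List ℕ} :
    [c, a, d].Sublist (x :: B) ↔ (c = x ∧ [a, d].Sublist B) ∨ [c, a, d].Sublist B := by
  rw [List.sublist_cons_iff]
  constructor
  · rintro (h | ⟨r, h, h'⟩)
    · tauto
    · simp at h; obtain ⟨rfl, rfl⟩ := h; tauto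
  · rintro (⟨rfl, h⟩ | h)
    · exact Or.inr ⟨_, rfl, h⟩
    · tauto

theorem sub_cons2 {a d x : ℕ} {B : List ℕ} :
    [a, d].Sublist (x :: B) ↔ (a = x ∧ d ∈ B) ∨ [a, d].Sublist B := by
  rw [List.sublist_cons_iff]
  constructor
  · rintro (h | ⟨r, h, h'⟩)
    · tauto
    · simp at h; obtain ⟨rfl, rfl⟩ := h; simp at h'; tauto
  · rintro (⟨rfl, h⟩ | h)
    · exact Or.inr ⟨[d], rfl, by simpa⟩
    · tauto

theorem mem_of_sub {P S : List ℕ} (h : S.Sublist P) {Z : ℕ → Prop} (hZ : ∀ x ∈ P, Z x) :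
    ∀ x ∈ S, Z x := fun x hx => hZ x (h.subset hx)

/-- In `ch`, a pattern entry list. -/
theorem mem_ch {N v x : ℕ} {P Q : List ℕ} {l r : Bool} (c : Ctx N v P Q)
    (h : x ∈ ch N v P Q l r) : x = N ∨ x ≤ v := by
  have := c.hP x
  have := c.hQ x
  cases l <;> cases r <;> simp [ch, mk] at h <;> grind

theorem sub_ch (N v : ℕ) (P Q : List ℕ) (l r : Bool) :
    (P ++ v :: Q).Sublist (ch N v P Q l r) := by
  unfold ch
  rw [List.append_assoc]
  refine List.Sublist.append (List.Sublist.refl _) ?_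
  refine List.Sublist.trans ?_ (List.sublist_append_right _ _)
  exact (List.sublist_append_right _ _).cons_cons v

theorem good1_child {N v : ℕ} {P Q : List ℕ} {l r : Bool} (c : Ctx N v P Q) :
    G1 (ch N v P Q l r) ↔ G1 (P ++ N :: Q) ∧ A1 N P := by
  have hv := c.vN
  have hPx := c.hP
  have hQx := c.hQ
  constructor
  · intro h
    constructor
    · intro a b c' d hs hlt
      have h0 := h a b c' d
      have h1 := h a b v d
      rw [sub_app4] at hs
      have hd : d < v := by
        have : d ∈ P ++ N :: Q := by
          rw [← sub_app4] at hs
          exact hs.subset (by simp)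
        have hc' : c' ∈ P ++ N :: Q := by
          rw [← sub_app4] at hs
          exact hs.subset (by simp)
        simp at this hc'
        have := hPx d
        have := hQx d
        have := hPx c'
        have := hQx c'
        grind
      have hS := sub_ch N v P Q l r
      replace h0 : ¬ [b, c', a, d].Sublist (P ++ v :: Q) := fun e => h0 (e.trans hS) hlt
      replace h1 : ¬ [b, v, a, d].Sublist (P ++ v :: Q) := fun e => h1 (e.trans hS) (by omega)
      clear h hS
      simp only [sub_app4, sub_app3, sub_app2, sub_cons4, sub_cons3,
        sub_cons2, List.mem_cons, not_or, not_and] at hs h0 h1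
      have : d ≠ N := by omega
      have : a ≠ N := by omega
      have : b ≠ N := by omega
      grind
    · rw [A1_iff]
      intro a b hs hb ha
      by_contra hn
      have hab : a ≠ b := by
        rintro rfl
        obtain ⟨X, Y, h0, hb', ha'⟩ := sub3_iff.1 hs
        have := c.nd
        simp [h0, List.pairwise_append] at this
        grind
      have e1 := mem_of_sub hs hPx
      simp at e1
      refine h a b N v ?_ ?_
      · simp only [ch, List.append_assoc, sub_app4]
        right; left
        exact ⟨hs, by simp⟩
      · omega
  · rintro ⟨h, h2⟩ a b c' d hs hlt
    rw [A1_iff] at h2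
    have m := mem_of_sub hs (fun x hx => mem_ch c hx)
    simp at m
    have h0 := h a b c' d
    have h1 := h a b N d
    have h2 := h2 a b
    have hbv : b < v := by omega
    have hav : a < v := by omega
    have : d ≠ N := by omega
    have : a ≠ N := by omega
    have : b ≠ N := by omega
    have : b ≠ v := by omega
    have : a ≠ v := by omega
    have : c' = v → d < v := by omega
    have : d = v → c' = N := by omega
    have : d < N := by omega
    have : a < N := by omega
    have : b < N := by omega
    have : ¬ b < a := by omega
    have : ¬ v = N := by omega
    have : a < b := by omega
    have : b < d := by omega
    have : d < c' := by omega
    have hc0 : c' = N → [b,c',a].Sublist P → False := by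
      rintro rfl hh
      have := h2 hh
      omega
    cases l <;> cases r <;>
    simp only [mk, Bool.false_eq_true, if_false, if_true, ch, List.append_assoc, sub_app4, sub_app3, sub_app2, sub_cons4, sub_cons3,
        sub_cons2, List.mem_append, List.mem_cons, List.nil_append, List.cons_append] at hs h0 h1 <;> 
      clear h h2 <;> grind

theorem good2_child {N v : ℕ} {P Q : List ℕ} {l r : Bool} (c : Ctx N v P Q) :
    G2 (ch N v P Q l r) ↔ G2 (P ++ N :: Q) ∧ A2 N P Q := by
  have hv := c.vN
  have hPx := c.hP
  have hQx := c.hQ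
  constructor
  · intro h
    constructor
    · intro a b c' d hs hlt
      have h0 := h a b c' d
      have h1 := h a b c' v
      have m : ∀ x ∈ P ++ N :: Q, x = N ∨ x < v := by
        intro x
        have := hPx x
        have := hQx x
        simp; grind
      have m := mem_of_sub hs m
      simp at m
      have hS := sub_ch N v P Q l r
      replace h0 : ¬ [b, c', a, d].Sublist (P ++ v :: Q) := fun e => h0 (e.trans hS) hlt
      replace h1 : ¬ [b, c', a, v].Sublist (P ++ v :: Q) := fun e => h1 (e.trans hS) (by omega)
      clear h hS
      simp only [sub_app4, sub_app3, sub_app2, sub_cons4, sub_cons3,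
        sub_cons2, List.mem_cons, not_or, not_and] at hs h0 h1
      have : c' < v := by omega
      have : c' ≠ N := by omega
      have : a ≠ N := by omega
      have : b ≠ N := by omega
      grind
    · rw [A2_iff]
      intro a b hs hs2 hb ha
      by_contra hn
      have e1 := mem_of_sub hs2 hQx
      have hab : a ≠ b := by
        rintro rfl
        have := c.nd
        have : a ∈ Q := hs2.subset (by simp)
        have := c.nd
        simp [List.pairwise_append] at this
        grind
      have := hPx b hs
      simp at e1
      refine h a b v N ?_ ?_
      · simp only [ch, List.append_assoc, sub_app4]
        right; right; right; left
        refine ⟨hs, ?_⟩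
        rw [sub_app3]
        right; right; right
        rw [sub_cons3]
        left
        refine ⟨rfl, ?_⟩
        rw [sub_app2]; tauto
      · omega
  · rintro ⟨h, h2⟩ a b c' d hs hlt
    rw [A2_iff] at h2
    have m := mem_of_sub hs (fun x hx => mem_ch c hx)
    simp at m
    have h0 := h a b c' d
    have h1 := h a b c' N
    have h2 := h2 a b
    have hbv : b < v := by omega
    have hav : a < v := by omega
    have : c' ≠ N := by omega
    have : a ≠ N := by omega
    have : b ≠ N := by omega
    have : b ≠ v := by omega
    have : a ≠ v := by omega
    have : c' = v → d = N := by omega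
    have : a < N := by omega
    have : b < N := by omega
    have : c' < N := by omega
    have : ¬ b < a := by omega
    have : ¬ v = N := by omega
    have : a < b := by omega
    have : b < c' := by omega
    have : c' < d := by omega
    have hc0 : d = N → b ∈ P → [a,d].Sublist Q → False := by
      rintro rfl hh h3
      have := h2 hh h3
      omega
    cases l <;> cases r <;>
    simp only [mk, Bool.false_eq_true, if_false, if_true, ch, List.append_assoc, sub_app4, sub_app3, sub_app2, sub_cons4, sub_cons3,
        sub_cons2, List.mem_append, List.mem_cons, List.nil_append, List.cons_append] at hs h0 h1 <;> 
      clear h h2 <;> grind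

theorem split_app {N : ℕ} {X Y P' Q' : List ℕ} (h : X ++ Y = P' ++ N :: Q') :
    (∃ P2, X = P' ++ N :: P2 ∧ Q' = P2 ++ Y) ∨ (∃ P2, P' = X ++ P2 ∧ Y = P2 ++ N :: Q') := by
  rw [List.append_eq_append_iff] at h
  rcases h with ⟨a, h1, h2⟩ | ⟨a, h1, h2⟩
  · exact Or.inr ⟨a, h1, h2⟩
  · rcases a with _ | ⟨z, a⟩
    · right; exact ⟨[], by simpa using h1.symm, by simpa using h2.symm⟩
    · simp at h2
      obtain ⟨rfl, rfl⟩ := h2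
      exact Or.inl ⟨a, h1, rfl⟩

theorem split_cons {N : ℕ} {X Y P' Q' : List ℕ} (h : X ++ N :: Y = P' ++ N :: Q') :
    (∃ P2, X = P' ++ N :: P2 ∧ Q' = P2 ++ N :: Y) ∨ (P' = X ∧ Q' = Y) ∨
      (∃ P2, P' = X ++ N :: P2 ∧ Y = P2 ++ N :: Q') := by
  rcases split_app h with h | ⟨P2, h1, h2⟩
  · exact Or.inl h
  · rcases P2 with _ | ⟨z, a⟩
    · simp at h1 h2; tauto
    · simp at h2
      obtain ⟨rfl, rfl⟩ := h2
      exact Or.inr (Or.inr ⟨a, h1, rfl⟩)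

theorem split_ch {N v : ℕ} {P Q P' Q' : List ℕ} {l r : Bool} (hv : v < N)
    (h : ch N v P Q l r = P' ++ N :: Q') :
    (∃ P2, P = P' ++ N :: P2 ∧ Q' = P2 ++ (mk N l ++ v :: (mk N r ++ Q))) ∨
    (l = true ∧ P' = P ∧ Q' = v :: (mk N r ++ Q)) ∨
    (r = true ∧ P' = P ++ mk N l ++ [v] ∧ Q' = Q) ∨
    (∃ Q1, Q = Q1 ++ N :: Q' ∧ P' = P ++ mk N l ++ v :: (mk N r ++ Q1)) := by
  unfold ch at h
  rw [List.append_assoc] at h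
  have hne : v ≠ N := by omega
  rcases split_app h with h | ⟨P2, h1, h2⟩
  · exact Or.inl h
  · rcases split_app h2 with ⟨P3, h3, h4⟩ | ⟨P3, h3, h4⟩
    · cases l <;> simp [mk] at h3
      rcases P2 with _ | ⟨z, P2⟩ <;> simp at h3
      subst h3
      right; left
      simp at h4 h1
      exact ⟨rfl, h1, h4⟩
    · rcases P3 with _ | ⟨z, P3⟩
      · simp [hne] at h4
      · simp at h4
        obtain ⟨rfl, h4⟩ := h4
        rcases split_app h4 with ⟨P5, h5, h6⟩ | ⟨P5, h5, h6⟩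
        · cases r <;> simp [mk] at h5
          rcases P3 with _ | ⟨z, P3⟩ <;> simp at h5
          subst h5
          right; right; left
          simp at h6
          subst h3 h1 h6
          simp
        · right; right; right
          refine ⟨P5, h6, ?_⟩
          subst h5 h3 h1
          simp

/-- The predicate in `dropWhile`. -/
noncomputable abbrev pr (N : ℕ) (P : List ℕ) : ℕ → Bool :=
  fun x => decide (∀ y ∈ P, y < N → y < x)

theorem J1_def (N : ℕ) (P Q : List ℕ) : J1 N P Q = P.count N + (Q.dropWhile (pr N P)).count N := rfl

theorem dw_pass {p : ℕ → Bool} {A B : List ℕ} (h : ∀ x ∈ A, p x = true) :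
    (A ++ B).dropWhile p = B.dropWhile p := by
  induction A with
  | nil => simp
  | cons a A ih => simp at h; simp [List.dropWhile_cons, h, ih h.2]

theorem dw_halt {p : ℕ → Bool} {A B : List ℕ} {a : ℕ} (ha : a ∈ A) (h : p a = false) :
    ∃ C, (A ++ B).dropWhile p = C ++ B := by
  induction A with
  | nil => simp at ha
  | cons x A ih =>
    by_cases hx : p x = true
    · simp at ha
      rcases ha with rfl | ha
      · simp [h] at hx
      · obtain ⟨C, hC⟩ := ih ha
        exact ⟨C, by simp [List.dropWhile_cons, hx, hC]⟩
    · exact ⟨x :: A, by simp [List.dropWhile_cons, hx]⟩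

theorem dw_count_le {p : ℕ → Bool} {A : List ℕ} (N : ℕ) : (A.dropWhile p).count N ≤ A.count N :=
  (List.dropWhile_sublist p).count_le N

theorem dw_mono {p q : ℕ → Bool} (h : ∀ x, p x = true → q x = true) (N : ℕ) (A : List ℕ) :
    (A.dropWhile q).count N ≤ (A.dropWhile p).count N := by
  induction A with
  | nil => simp
  | cons x A ih =>
    by_cases hx : p x = true
    · simpa [List.dropWhile_cons, hx, h x hx] using ih
    · have := dw_count_le (p := q) (A := x :: A) N
      simpa [List.dropWhile_cons (p := p), hx] using this

theorem dw_head {N v : ℕ} {P Q : List ℕ} (hv : v ∈ P) (hN : v < N) (hQ : ∀ x ∈ Q.head?, x < v) :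
    Q.dropWhile (pr N P) = Q := by
  cases Q with
  | nil => simp
  | cons q Q =>
    simp at hQ
    have : pr N P q = false := by
      simp only [pr, decide_eq_false_iff_not]
      intro h
      have := h v hv hN
      omega
    simp only [List.dropWhile_cons, this]
    simp

theorem A1.sub {N : ℕ} {P P1 : List ℕ} (h : A1 N P) (hs : P1.Sublist P) : A1 N P1 := by
  rw [A1_iff] at *
  exact fun a b e => h a b (e.trans hs)

theorem A1.pass {N : ℕ} {P1 P2 : List ℕ} (h : A1 N (P1 ++ N :: P2))
    (hle : ∀ x ∈ P2, x = N ∨ x < N) : ∀ x ∈ P2, pr N P1 x = true := by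
  intro x hx
  simp only [pr, decide_eq_true_eq]
  intro y hy hyN
  rcases hle x hx with rfl | hxN
  · exact hyN
  · exact h P1 P2 rfl y hy x hx hyN hxN

theorem J1_pass {N : ℕ} {P A B : List ℕ} (h : ∀ x ∈ A, pr N P x = true) :
    J1 N P (A ++ B) = P.count N + (B.dropWhile (pr N P)).count N := by
  rw [J1_def, dw_pass h]

theorem pr_N (N : ℕ) (P : List ℕ) : pr N P N = true := by
  simp [pr]

theorem pr_v {N v : ℕ} {P : List ℕ} (h : ∀ x ∈ P, x = N ∨ x < v) : pr N P v = true := by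
  simp only [pr, decide_eq_true_eq]
  intro y hy hyN
  have := h y hy
  omega

theorem mem_mk {N x : ℕ} {b : Bool} (h : x ∈ mk N b) : x = N := by
  cases b <;> simp [mk] at h; exact h

theorem K2 {N : ℕ} {P1 P2 Q : List ℕ} (h : A1 N (P1 ++ N :: P2))
    (hle : ∀ x ∈ P2, x = N ∨ x < N) :
    J1 N P1 (P2 ++ N :: Q) < J1 N (P1 ++ N :: P2) Q := by
  have h1 : ∀ x ∈ P2 ++ [N], pr N P1 x = true := by
    intro x hx
    simp at hx
    rcases hx with hx | rfl
    · exact h.pass hle x hx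
    · exact pr_N _ _
  have := J1_pass (B := Q) h1
  simp only [List.append_assoc, List.singleton_append] at this
  rw [this, J1_def]
  have := dw_mono (p := pr N (P1 ++ N :: P2)) (q := pr N P1) (by
    intro x; simp only [pr, decide_eq_true_eq]; intro h y hy; exact h y (by simp [hy])) N Q
  simp
  omega

theorem K1 {N v : ℕ} {P1 P2 Q : List ℕ} {l r : Bool} (h : A1 N (P1 ++ N :: P2))
    (hle : ∀ x ∈ P1 ++ N :: P2, x = N ∨ x < v) (hv : v < N) :
    J1 N P1 (P2 ++ (mk N l ++ v :: (mk N r ++ Q))) = J1 N P1 (P2 ++ N :: Q) := by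
  have hp := h.pass (fun x hx => by have := hle x (by simp [hx]); omega)
  have e : P2 ++ (mk N l ++ v :: (mk N r ++ Q)) = (P2 ++ mk N l ++ v :: mk N r) ++ Q := by simp
  have e2 : P2 ++ N :: Q = (P2 ++ [N]) ++ Q := by simp
  have hvp : pr N P1 v = true := pr_v (fun x hx => hle x (by simp [hx]))
  have := pr_N N P1
  rw [e, e2, J1_pass, J1_pass]
  · intro x hx
    simp only [List.mem_append, List.mem_singleton] at hx
    rcases hx with hx | hx
    · exact hp x hx
    · rw [hx]; exact pr_N _ _
  · intro x hx
    simp only [List.mem_append, List.mem_cons] at hx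
    rcases hx with (hx | hx) | hx | hx
    · exact hp x hx
    · rw [mem_mk hx]; exact pr_N _ _
    · rw [hx]; exact hvp
    · rw [mem_mk hx]; exact pr_N _ _

theorem J1_le {N : ℕ} {P Q : List ℕ} : J1 N P Q + 1 ≤ (P ++ N :: Q).count N := by
  rw [J1_def]
  have := dw_count_le (p := pr N P) (A := Q) N
  simp
  omega

theorem J1_inj {N : ℕ} {P Q P' Q' : List ℕ} (h : P ++ N :: Q = P' ++ N :: Q')
    (hle : ∀ x ∈ P ++ N :: Q, x = N ∨ x < N) (h1 : A1 N P) (h2 : A1 N P')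
    (hJ : J1 N P Q = J1 N P' Q') : P = P' ∧ Q = Q' := by
  rcases split_cons h with ⟨P2, rfl, rfl⟩ | h | ⟨P2, rfl, rfl⟩
  · have := K2 (Q := Q) h1 (fun x hx => hle x (by simp [hx]))
    omega
  · simp [h]
  · have := K2 (Q := Q') h2 (fun x hx => hle x (by simp [hx]))
    omega

/-- splitting at the last marker -/
theorem last_marker {N : ℕ} {W : List ℕ} (h : N ∈ W) : ∃ X Y, W = X ++ N :: Y ∧ N ∉ Y := by
  induction W with
  | nil => simp at h
  | cons w W ih =>
    by_cases hw : N ∈ W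
    · obtain ⟨X, Y, rfl, hY⟩ := ih hw
      exact ⟨w :: X, Y, by simp, hY⟩
    · simp [hw] at h
      exact ⟨[], W, by simp [h], hw⟩

theorem first_marker {N : ℕ} {W : List ℕ} (h : N ∈ W) : ∃ X Y, W = X ++ N :: Y ∧ N ∉ X := by
  induction W with
  | nil => simp at h
  | cons w W ih =>
    by_cases hw : w = N
    · exact ⟨[], W, by simp [hw], by simp⟩
    · simp [Ne.symm hw] at h
      obtain ⟨X, Y, rfl, hX⟩ := ih h
      exact ⟨w :: X, Y, by simp, by simp [hX]; omega⟩

theorem Ctx.headQ {N v : ℕ} {P Q A B : List ℕ} (c : Ctx N v P Q) (h : Q = A ++ N :: B) :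
    ∀ x ∈ B.head?, x < v := by
  intro x hx
  have h1 := c.chQ
  subst h
  simp only [List.isChain_append, List.isChain_cons] at h1
  have h2 := h1.2.1.1 x hx
  have h3 := c.hQ x (by
    have := List.mem_of_mem_head? hx
    simp [this])
  grind

theorem Ctx.headQ0 {N v : ℕ} {P Q : List ℕ} (c : Ctx N v P Q) : ∀ x ∈ Q.head?, x < v := by
  intro x hx
  have h1 := c.hQh x hx
  have h3 := c.hQ x (List.mem_of_mem_head? hx)
  grind

theorem A1.after {N v w : ℕ} {Z W : List ℕ} (h : A1 N (Z ++ N :: W)) (hv : v ∈ Z) (hvN : v < N)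
    (hw : w ∈ W) (hwv : w < v) : False := by
  have := h Z W rfl v hv w hw hvN (by omega)
  omega

/-- For case (iv): the block after `v` has no marker. -/
theorem case4 {N v : ℕ} {P Q1 Q' W : List ℕ} {r : Bool} (c : Ctx N v P (Q1 ++ N :: Q'))
    (h : A1 N (W ++ v :: (mk N r ++ Q1))) : r = false ∧ N ∉ Q1 := by
  have hv := c.vN
  constructor
  · by_contra hr
    simp at hr
    subst hr
    have h0 := c.headQ0
    rcases Q1 with _ | ⟨q, Q1⟩
    · simp at h0; omega
    · simp at h0
      have h' : A1 N ((W ++ [v]) ++ N :: q :: Q1) := by simpa [mk] using h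
      exact h'.after (w := q) (v := v) (by simp) hv (by simp) h0
  · intro hN
    obtain ⟨X, Y, rfl, -⟩ := last_marker hN
    have h0 := c.headQ (A := X) (B := Y ++ N :: Q') (by simp)
    rcases Y with _ | ⟨q, Y⟩
    · simp at h0; omega
    · simp at h0
      have h' : A1 N ((W ++ v :: (mk N r ++ X)) ++ N :: q :: Y) := by simpa [mk] using h
      exact h'.after (w := q) (v := v) (by simp) hv (by simp) h0

theorem A1_mk {N : ℕ} {P : List ℕ} {l : Bool} (h : A1 N P) : A1 N (P ++ mk N l) := by
  rw [A1_iff] at *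
  intro a b hs hb ha
  refine h a b ?_ hb ha
  rw [sub_app3] at hs
  have e1 : a ∉ mk N l := fun h => by have := mem_mk h; omega
  rcases hs with h | h | h | h
  · exact h
  · exact absurd h.2 e1
  · exact absurd (h.2.subset (by simp)) e1
  · exact absurd (h.subset (by simp)) e1

theorem A1_v {N v : ℕ} {W : List ℕ} (h : A1 N W) (hW : ∀ x ∈ W, x = N ∨ x < v) (hv : v < N) :
    A1 N (W ++ [v]) := by
  rw [A1_iff] at *
  intro a b hs hb ha
  rw [sub_app3] at hs
  rcases hs with h' | h' | h' | h'
  · exact h a b h' hb ha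
  · have h1 := hW b (h'.1.subset (by simp))
    simp at h'
    omega
  · have := h'.2.length_le; simp at this
  · have := h'.length_le; simp at this

theorem S1_child {N v : ℕ} {P Q : List ℕ} {l r : Bool} (c : Ctx N v P Q) (hA : A1 N P)
    (hl : P = [] → l = true) (x : ℕ) :
    S1 N (ch N v P Q l r) x ↔ (S1 N (P ++ N :: Q) x ∧ x < J1 N P Q) ∨
      (l = true ∧ x = J1 N P Q) ∨ x + 1 = (ch N v P Q l r).count N := by
  have hv := c.vN
  have hPx := c.hP
  have hQx := c.hQ
  have hc := count_ch (P := P) (Q := Q) (l := l) (r := r) hv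
  have hcW : (P ++ mk N l).count N = P.count N + l.toNat := by
    cases l <;> simp [mk]
  have hW : ∀ x ∈ P ++ mk N l, x = N ∨ x < v := by
    intro x hx
    simp only [List.mem_append] at hx
    rcases hx with hx | hx
    · exact hPx x hx
    · exact Or.inl (mem_mk hx)
  have hvne : v ≠ N := by omega
  have hAW : A1 N (P ++ mk N l) := A1_mk hA
  have JP : J1 N P (v :: (mk N r ++ Q)) = J1 N P Q := by
    have : v :: (mk N r ++ Q) = (v :: mk N r) ++ Q := by simp
    rw [this, J1_pass, J1_def]
    intro x hx
    simp only [List.mem_cons] at hx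
    rcases hx with rfl | hx
    · exact pr_v hPx
    · rw [mem_mk hx]; exact pr_N _ _
  constructor
  · rintro ⟨P', Q', h, hA', rfl⟩
    rcases split_ch hv h with ⟨P2, rfl, rfl⟩ | ⟨hl', rfl, rfl⟩ | ⟨hr, rfl, rfl⟩ | ⟨Q1, rfl, rfl⟩
    · left
      rw [K1 hA hPx hv]
      exact ⟨⟨P', _, by simp, hA', rfl⟩, K2 hA (fun x hx => by
        have := hPx x (by simp [hx]); omega)⟩
    · right; left
      exact ⟨hl', JP⟩
    · right; right
      rw [J1_def, dw_head (v := v) (by simp) hv c.headQ0, hc, hr, List.count_append, hcW]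
      simp [hvne]
      omega
    · right; right
      obtain ⟨hr, hN⟩ := case4 c hA'
      rw [J1_def, dw_head (v := v) (by simp) hv (c.headQ rfl), hc, hr]
      have : Q1.count N = 0 := List.count_eq_zero.2 hN
      simp only [List.count_append, hcW, hr, mk, List.count_cons, this] at *
      simp [hvne]
      omega
  · rintro (⟨⟨P', Q', h, hA', rfl⟩, hlt⟩ | ⟨hl, rfl⟩ | hx)
    · rcases split_cons h with ⟨P2, rfl, rfl⟩ | ⟨rfl, rfl⟩ | ⟨P2, rfl, rfl⟩
      · refine ⟨P', P2 ++ (mk N l ++ v :: (mk N r ++ Q)), by simp [ch], hA', ?_⟩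
        rw [K1 hA hPx hv]
      · omega
      · have := K2 (Q := Q') hA' (fun x hx => by have := hQx x (by simp [hx]); omega)
        omega
    · refine ⟨P, v :: (mk N r ++ Q), by simp [ch, hl, mk], hA, JP.symm⟩
    · cases hr : r with
      | true =>
        refine ⟨P ++ mk N l ++ [v], Q, by simp [ch, mk], A1_v hAW hW hv, ?_⟩
        rw [J1_def, dw_head (v := v) (by simp) hv c.headQ0, List.count_append, hcW]
        subst hr
        simp [hvne] at *
        omega
      | false =>
        by_cases hg : ∃ Q1 Q2, Q = Q1 ++ N :: Q2 ∧ N ∉ Q1 ∧ A1 N (P ++ mk N l ++ v :: Q1)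
        · obtain ⟨Q1, Q2, rfl, hN, hA1⟩ := hg
          refine ⟨P ++ mk N l ++ v :: Q1, Q2, by simp [ch, mk], hA1, ?_⟩
          rw [J1_def, dw_head (v := v) (by simp) hv (c.headQ rfl)]
          have : Q1.count N = 0 := List.count_eq_zero.2 hN
          rw [List.count_append, hcW]
          subst hr
          simp [hvne, this] at *
          omega
        · have hNW : N ∈ P ++ mk N l := by
            rcases c.hP0 with h0 | ⟨t, h0⟩
            · simp [mk, hl h0]
            · simp [h0]
          obtain ⟨X, Y, hXY, hNY⟩ := last_marker hNW
          have hAX : A1 N X := hAW.sub (by rw [hXY]; simp)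
          refine ⟨X, Y ++ v :: Q, by simp [ch, mk, ← List.append_assoc] ; simp [mk] at hXY; simp [hXY], hAX, ?_⟩
          rw [hXY] at hAW hW hcW hg
          have hpass : ∀ x ∈ Y ++ [v], pr N X x = true := by
            intro x hx
            simp at hx
            rcases hx with hx | rfl
            · exact hAW.pass (fun x hx => by have := hW x (by simp [hx]); omega) x hx
            · exact pr_v (fun y hy => hW y (by simp [hy]))
          have e : Y ++ v :: Q = (Y ++ [v]) ++ Q := by simp
          rw [e, J1_pass hpass]
          have hcY : Y.count N = 0 := List.count_eq_zero.2 hNY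
          have key : (Q.dropWhile (pr N X)).count N = Q.count N := by
            by_cases hNQ : N ∈ Q
            · obtain ⟨Q1, Q2, rfl, hN1⟩ := first_marker hNQ
              have hnA : ¬ A1 N ((X ++ N :: Y) ++ v :: Q1) := fun hh => hg ⟨Q1, Q2, rfl, hN1, hh⟩
              have : ∃ a ∈ Q1, pr N X a = false := by
                by_contra hcon
                push Not at hcon
                apply hnA
                intro A B hAB b hb a ha hbN haN
                have hAB' : X ++ N :: (Y ++ v :: Q1) = A ++ N :: B := by rw [← hAB]; simp
                have hpr : ∀ a ∈ Y ++ v :: Q1, pr N X a = true := by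
                  intro a ha
                  simp at ha
                  rcases ha with ha | ha | ha
                  · exact hpass a (by simp [ha])
                  · exact hpass a (by simp [ha])
                  · simpa using hcon a ha
                rcases split_cons hAB' with ⟨P2, rfl, rfl⟩ | ⟨rfl, rfl⟩ | ⟨P2, rfl, hh⟩
                · simp at ha
                  have hX' : ∀ y ∈ A, y ∈ A ++ N :: P2 := fun y hy => by simp [hy]
                  have : a ∈ P2 ∨ a ∈ Y ++ v :: Q1 := by simp; grind
                  rcases this with h1 | h1
                  · exact hAX A P2 rfl b hb a h1 hbN haN
                  · have := hpr a h1
                    simp only [pr, decide_eq_true_eq] at this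
                    exact this b (hX' b hb) hbN
                · have := hpr a ha
                  simp only [pr, decide_eq_true_eq] at this
                  exact this b hb hbN
                · exfalso
                  have : N ∈ Y ++ v :: Q1 := by rw [hh]; simp
                  simp [hNY, hN1] at this
                  omega
              obtain ⟨a, ha, hpa⟩ := this
              obtain ⟨C, hC⟩ := dw_halt (B := N :: Q2) ha hpa
              have h1 := dw_count_le (p := pr N X) (A := Q1 ++ N :: Q2) N
              rw [hC] at h1 ⊢
              have : Q1.count N = 0 := List.count_eq_zero.2 hN1
              simp [this] at h1 ⊢
              exact h1
            · have : Q.count N = 0 := List.count_eq_zero.2 hNQ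
              have h1 := dw_count_le (p := pr N X) (A := Q) N
              omega
          rw [key]
          subst hr
          simp [hcY] at *
          omega

theorem J2_inj {N : ℕ} {P Q P' Q' : List ℕ} (h : P ++ N :: Q = P' ++ N :: Q')
    (hJ : J2 N P = J2 N P') : P = P' ∧ Q = Q' := by
  unfold J2 at hJ
  rcases split_cons h with ⟨P2, rfl, rfl⟩ | h | ⟨P2, rfl, rfl⟩
  · simp at hJ
  · simp [h]
  · simp at hJ

theorem A2.tail {N v : ℕ} {P Q : List ℕ} (h : A2 N P Q) (hv : v ∈ P) (hvN : v < N)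
    (hQ : ∀ x ∈ Q.head?, x < v) : N ∉ Q := by
  intro hN
  obtain ⟨X, Y, rfl, -⟩ := first_marker hN
  rcases X with _ | ⟨q, X⟩
  · simp at hQ; omega
  · simp at hQ
    have := h (q :: X) Y rfl v hv q (by simp) hvN (by omega)
    omega

theorem case2i {N v : ℕ} {P' P2 Q : List ℕ} {l r : Bool} (c : Ctx N v (P' ++ N :: P2) Q)
    (hG : G2 ((P' ++ N :: P2) ++ N :: Q))
    (hA' : A2 N P' (P2 ++ (mk N l ++ v :: (mk N r ++ Q))))
    (hx : ¬ P'.count N + 1 = (ch N v (P' ++ N :: P2) Q l r).count N) :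
    A2 N P' (P2 ++ N :: Q) := by
  have hv := c.vN
  rw [count_ch hv] at hx
  rw [A2_iff] at hA' ⊢
  intro a b hb hs hbN haN
  have h0 := hA' a b hb
  by_cases hs' : [a, N].Sublist (P2 ++ (mk N l ++ v :: (mk N r ++ Q)))
  · exact h0 hs' hbN haN
  have haNe : a ≠ N := by omega
  rw [sub_app2, sub_cons2] at hs
  rw [sub_app2] at hs'
  push Not at hs'
  obtain ⟨n1, n2, n3⟩ := hs'
  have n3' : ¬ [a, N].Sublist Q := fun h => n3 (h.trans (by
    rw [← List.singleton_append (l := mk N r ++ Q), ← List.append_assoc, ← List.append_assoc]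
    exact List.sublist_append_right _ _))
  have ha : a ∈ P2 := by tauto
  have n4 := n2 ha
  have hlr : l = false ∧ r = false ∧ N ∉ Q := by
    cases l <;> cases r <;> simp [mk] at n4 ⊢ <;> tauto
  obtain ⟨rfl, rfl, hNQ⟩ := hlr
  have hcQ : Q.count N = 0 := List.count_eq_zero.2 hNQ
  have hNP2 : N ∈ P2 := by
    by_contra hh
    have : P2.count N = 0 := List.count_eq_zero.2 hh
    simp [this, hcQ] at hx
  obtain ⟨Z, W, rfl, hNZ⟩ := first_marker hNP2
  have hchP := c.chP
  simp only [List.isChain_append, List.isChain_cons] at hchP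
  rcases Z with _ | ⟨z, Z⟩
  · simp at hchP
  · have hz : z < v := by
      have := c.hP z (by simp)
      simp at hNZ
      omega
    have haZ : a ∉ z :: Z := by
      intro h
      apply n1
      rw [sub_app2]
      right; left
      exact ⟨h, by simp⟩
    have haW : a ∈ W := by
      rcases List.mem_append.1 ha with h | h
      · exact absurd h haZ
      · simpa [haNe] using h
    have hbz : b < z := by
      refine hA' z b hb ?_ hbN (by omega)
      rw [sub_app2]
      left
      rw [sub_app2]
      right; left; simp
    by_contra hab
    have hne : a ≠ b := by
      rintro rfl
      have := c.nd
      simp only [List.append_assoc, List.pairwise_append] at this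
      have := this.2.2 a hb a (by simp [haW])
      simp at this
      omega
    refine hG a b z N ?_ (by omega)
    have s1 : [b].Sublist P' := by simpa using hb
    have s2 : [z].Sublist (N :: z :: Z) := by simp
    have s3 : [a].Sublist (N :: W) := by simp [haW]
    have s4 : [N].Sublist (N :: Q) := by simp
    have := s1.append (s2.append (s3.append s4))
    simpa using this

theorem S2_child {N v : ℕ} {P Q : List ℕ} {l r : Bool} (c : Ctx N v P Q)
    (hG : G2 (P ++ N :: Q)) (hA : A2 N P Q)
    (hl : P = [] → l = true) (x : ℕ) :
    S2 N (ch N v P Q l r) x ↔ (S2 N (P ++ N :: Q) x ∧ x < J2 N P) ∨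
      (l = true ∧ x = J2 N P) ∨ x + 1 = (ch N v P Q l r).count N := by
  have hv := c.vN
  have hPx := c.hP
  have hQx := c.hQ
  have hc := count_ch (P := P) (Q := Q) (l := l) (r := r) hv
  have hcW : ∀ b, (mk N b).count N = b.toNat := by
    intro b
    cases b <;> simp [mk]
  have hvne : v ≠ N := by omega
  constructor
  · rintro ⟨P', Q', h, hA', rfl⟩
    rcases split_ch hv h with ⟨P2, rfl, rfl⟩ | ⟨hl', rfl, rfl⟩ | ⟨hr, rfl, rfl⟩ | ⟨Q1, rfl, rfl⟩
    · by_cases hx : J2 N P' + 1 = (ch N v (P' ++ N :: P2) Q l r).count N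
      · tauto
      · left
        refine ⟨⟨P', P2 ++ N :: Q, by simp, case2i c hG hA' hx, rfl⟩, ?_⟩
        simp [J2]
    · right; left
      exact ⟨hl', rfl⟩
    · right; right
      have : Q'.count N = 0 := List.count_eq_zero.2 (hA'.tail (v := v) (by simp) hv c.headQ0)
      rw [hc, hr, this]
      simp [J2, hcW, hvne]
    · right; right
      have : Q'.count N = 0 := List.count_eq_zero.2 (hA'.tail (v := v) (by simp) hv (c.headQ rfl))
      rw [hc]
      simp [J2, hcW, hvne, this]
      omega
  · rintro (⟨⟨P', Q', h, hA', rfl⟩, hlt⟩ | ⟨hl, rfl⟩ | hx)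
    · unfold J2 at hlt
      rcases split_cons h with ⟨P2, rfl, rfl⟩ | ⟨rfl, rfl⟩ | ⟨P2, rfl, rfl⟩
      · refine ⟨P', P2 ++ (mk N l ++ v :: (mk N r ++ Q)), by simp [ch], ?_, rfl⟩
        rw [A2_iff] at hA' ⊢
        intro a b hb hs hbN haN
        have h0 := hA' a b hb
        have hb' := hPx b (by simp [hb])
        have haNe : a ≠ N := by omega
        have e1 : ∀ b, a ∉ mk N b := fun b h => by have := mem_mk h; omega
        have e2 : ∀ b, ¬ [a, N].Sublist (mk N b) := fun b h => e1 b (h.subset (by simp))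
        simp only [sub_app2, sub_cons2, e1, e2, false_and, false_or] at hs h0
        rcases hs with hs | hs | hs | hs
        · exact h0 (Or.inl hs) hbN haN
        · exact h0 (Or.inr (Or.inl ⟨hs.1, by simp⟩)) hbN haN
        · omega
        · exact h0 (Or.inr (Or.inr (Or.inr hs))) hbN haN
      · omega
      · simp at hlt
    · refine ⟨P, v :: (mk N r ++ Q), by simp [ch, hl, mk], ?_, rfl⟩
      rw [A2_iff] at hA ⊢
      intro a b hb hs hbN haN
      have h0 := hA a b hb
      have hb' := hPx b (by simp [hb])
      have haNe : a ≠ N := by omega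
      have e1 : ∀ b, a ∉ mk N b := fun b h => by have := mem_mk h; omega
      have e2 : ∀ b, ¬ [a, N].Sublist (mk N b) := fun b h => e1 b (h.subset (by simp))
      simp only [sub_app2, sub_cons2, e1, e2, false_and, false_or] at hs
      rcases hs with hs | hs
      · omega
      · exact h0 hs hbN haN
    · have hN : N ∈ ch N v P Q l r := by
        rw [← List.count_pos_iff]; omega
      obtain ⟨X, Y, h, hY⟩ := last_marker hN
      refine ⟨X, Y, h, ?_, ?_⟩
      · intro X' Y' h' 
        exfalso
        apply hY
        rw [h']
        simp
      · rw [h] at hx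
        have : Y.count N = 0 := List.count_eq_zero.2 hY
        simp [this] at hx
        exact hx

theorem J1_zero {N v : ℕ} {P Q : List ℕ} (c : Ctx N v P Q) : J1 N P Q = 0 ↔ P = [] := by
  constructor
  · intro h
    rcases c.hP0 with h0 | ⟨t, h0⟩
    · exact h0
    · simp [J1_def, h0] at h
  · rintro rfl
    have : Q.dropWhile (pr N []) = [] := by simp
    rw [J1_def, this]
    simp

theorem J2_zero {N v : ℕ} {P Q : List ℕ} (c : Ctx N v P Q) : J2 N P = 0 ↔ P = [] := by
  constructor
  · intro h
    rcases c.hP0 with h0 | ⟨t, h0⟩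
    · exact h0
    · simp [J2, h0] at h
  · rintro rfl
    simp [J2]

def opT (x : ℕ) (u : List ℕ) : Prop := ¬ u.IsChain (fun a b => b = x → x ≤ a)
def opA (x : ℕ) (u : List ℕ) : Prop := ¬ u.IsChain (fun a b => a = x → b ≤ x)
def opM (x : ℕ) (u : List ℕ) : Prop := u.Pairwise (fun a b => b = x → x < a)

theorem opT_lt {N v x : ℕ} {P Q : List ℕ} {l r : Bool} (c : Ctx N v P Q) (hx : x < v) :
    opT x (ch N v P Q l r) ↔ opT x (P ++ N :: Q) := by
  have hv := c.vN
  have : v ≠ x := by omega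
  have : N ≠ x := by omega
  have : x ≤ v := by omega
  have : x ≤ N := by omega
  unfold opT
  cases l <;> cases r <;>
    simp [ch, mk, List.isChain_append, List.isChain_cons, *]

theorem opA_lt {N v x : ℕ} {P Q : List ℕ} {l r : Bool} (c : Ctx N v P Q) (hx : x < v) :
    opA x (ch N v P Q l r) ↔ opA x (P ++ N :: Q) := by
  have hv := c.vN
  have : v ≠ x := by omega
  have : N ≠ x := by omega
  have : ¬ v ≤ x := by omega
  have : ¬ N ≤ x := by omega
  have : ¬ v < x := by omega
  have : ¬ N < x := by omega
  unfold opA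
  cases l <;> cases r <;>
    simp [ch, mk, List.isChain_append, List.isChain_cons, *]

theorem opM_lt {N v x : ℕ} {P Q : List ℕ} {l r : Bool} (c : Ctx N v P Q) (hx : x < v) :
    opM x (ch N v P Q l r) ↔ opM x (P ++ N :: Q) := by
  have hv := c.vN
  have : v ≠ x := by omega
  have : N ≠ x := by omega
  have : x < N := by omega
  unfold opM
  cases l <;> cases r <;>
    simp [ch, mk, List.pairwise_append, *]

theorem Ctx.vP {N v : ℕ} {P Q : List ℕ} (c : Ctx N v P Q) : v ∉ P := by
  intro h
  have := c.hP v h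
  have := c.vN
  omega

theorem Ctx.vQ {N v : ℕ} {P Q : List ℕ} (c : Ctx N v P Q) : v ∉ Q := by
  intro h
  have := c.hQ v h
  have := c.vN
  omega

theorem chain_b {v : ℕ} {P : List ℕ} (h : v ∉ P) : P.IsChain (fun a b => b = v → v ≤ a) := by
  induction P with
  | nil => simp
  | cons p P ih =>
    simp at h
    rw [List.isChain_cons]
    refine ⟨fun y hy e => ?_, ih h.2⟩
    have := List.mem_of_mem_head? hy
    subst e
    tauto

theorem chain_a {v : ℕ} {P : List ℕ} (h : v ∉ P) : P.IsChain (fun a b => a = v → b ≤ v) := by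
  induction P with
  | nil => simp
  | cons p P ih =>
    simp at h
    rw [List.isChain_cons]
    refine ⟨fun y hy e => ?_, ih h.2⟩
    omega

theorem opT_v {N v : ℕ} {P Q : List ℕ} {l r : Bool} (c : Ctx N v P Q)
    (hl : P = [] → l = true) :
    opT v (ch N v P Q l r) ↔ l = false := by
  have hv := c.vN
  have h1 : v ≠ N := by omega
  have h2 : N ≠ v := by omega
  have h3 : v ≤ N := by omega
  have cP := chain_b c.vP
  have cQ := chain_b c.vQ
  have hQ : ∀ y ∈ Q.head?, y ≠ v := by
    rintro y hy rfl
    exact c.vQ (List.mem_of_mem_head? hy)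
  unfold opT
  cases l
  · simp only [iff_true]
    simp only [Bool.false_eq_true, imp_false] at hl
    rcases List.eq_nil_or_concat' P with h0 | ⟨Z, z, rfl⟩
    · exact absurd h0 hl
    · have e1 := c.hPl
      have e2 := c.hP z (by simp)
      simp at e1
      intro h
      simp only [ch, mk, Bool.false_eq_true, if_false, List.append_nil] at h
      have := (List.isChain_append.1 h).2.2 z (by simp) v (by simp) rfl
      omega
  · cases r <;>
      simp [ch, mk, List.isChain_append, List.isChain_cons, cP, cQ, h1, h2, h3] <;>
      simpa using hQ

theorem opA_v {N v : ℕ} {P Q : List ℕ} {l r : Bool} (c : Ctx N v P Q) :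
    opA v (ch N v P Q l r) ↔ r = true := by
  have hv := c.vN
  have h1 : v ≠ N := by omega
  have h2 : N ≠ v := by omega
  have h3 : ¬ N ≤ v := by omega
  have cP := chain_a c.vP
  have cQ := chain_a c.vQ
  have hQ : ∀ y ∈ Q.head?, y ≤ v := by
    intro y hy 
    have := c.headQ0 y hy
    omega
  have hP : ∀ y ∈ P.getLast?, y ≠ v := by
    rintro y hy rfl
    exact c.vP (List.mem_of_getLast? hy)
  unfold opA
  cases r
  · have hP' : v ∉ P.getLast? := fun h => hP v h rfl
    cases l <;>
      simp [ch, mk, List.isChain_append, List.isChain_cons, cP, cQ, h1, h2, h3] <;> grind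
  · cases l <;>
      simp [ch, mk, List.isChain_append, List.isChain_cons, cP, cQ, h1, h2, h3] <;> omega

theorem opM_v {N v : ℕ} {P Q : List ℕ} {l r : Bool} (c : Ctx N v P Q) :
    opM v (ch N v P Q l r) ↔ P = [] := by
  have hv := c.vN
  have h1 : v ≠ N := by omega
  have h2 : N ≠ v := by omega
  have hQ : ∀ y ∈ Q, y ≠ v := by
    rintro y hy rfl
    exact c.vQ hy
  unfold opM
  constructor
  · intro h
    rcases List.eq_nil_or_concat' P with h0 | ⟨Z, z, rfl⟩
    · exact h0
    · have e1 := c.hPl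
      have e2 := c.hP z (by simp)
      simp at e1
      have := (List.pairwise_append.1 h).2.2 z (by simp) v (by simp) rfl
      omega
  · rintro rfl
    have hp : Q.Pairwise (fun a b => b = v → v < a) := by
      rw [List.pairwise_iff_forall_sublist]
      intro a b hs e
      exact absurd e (hQ b (hs.subset (by simp)))
    cases l <;> cases r <;>
    simp [ch, mk, h1, h2, hv, hp] <;> grind

structure Inv (N k : ℕ) (u w : List ℕ) : Prop where
  wu : Word N k u
  ww : Word N k w
  gu : G1 u
  gw : G2 w
  ss : ∀ x, S1 N u x ↔ S2 N w x
  cc : u.count N = w.count N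
  oT : ∀ x, 1 ≤ x → x ≤ k → (opT x u ↔ opT x w)
  oA : ∀ x, 1 ≤ x → x ≤ k → (opA x u ↔ opA x w)
  oM : ∀ x, 1 ≤ x → x ≤ k → (opM x u ↔ opM x w)

def R (N : ℕ) : ℕ → List ℕ → List ℕ → Prop
  | 0, u, w => u = [N] ∧ w = [N]
  | k + 1, u, w => ∃ P Q P' Q' l r, R N k (P ++ N :: Q) (P' ++ N :: Q') ∧
      A1 N P ∧ A2 N P' Q' ∧ J1 N P Q = J2 N P' ∧ (P = [] → l = true) ∧ (P' = [] → l = true) ∧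
      u = ch N (k+1) P Q l r ∧ w = ch N (k+1) P' Q' l r

theorem word_zero {N : ℕ} {u : List ℕ} : Word N 0 u ↔ u = [N] := by
  constructor
  · rintro ⟨⟨t, rfl⟩, hc, -, hm⟩
    rcases t with _ | ⟨y, t⟩
    · rfl
    · have := hm y
      simp at this
      simp at hc
      omega
  · rintro rfl
    refine ⟨⟨[], rfl⟩, by simp, by simp, ?_⟩
    intro x; simp; omega

theorem R_inv {N k : ℕ} (hk : k < N) {u w : List ℕ} (h : R N k u w) : Inv N k u w := by
  induction k generalizing u w with
  | zero =>
    obtain ⟨rfl, rfl⟩ := h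
    refine ⟨word_zero.2 rfl, word_zero.2 rfl, ?_, ?_, ?_, rfl, fun x _ _ => by omega,
      fun x _ _ => by omega, fun x _ _ => by omega⟩
    · intro a b c d hs
      have := hs.length_le; simp at this
    · intro a b c d hs
      have := hs.length_le; simp at this
    · intro x
      constructor
      · rintro ⟨P, Q, h, -, rfl⟩
        rw [List.singleton_eq_append_iff] at h
        rcases h with ⟨rfl, h⟩ | ⟨-, h⟩
        · simp at h
          subst h
          exact ⟨[], [], rfl, fun X Y h => by simp at h, by simp [J1, J2]⟩
        · simp at h
      · rintro ⟨P, Q, h, -, rfl⟩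
        rw [List.singleton_eq_append_iff] at h
        rcases h with ⟨rfl, h⟩ | ⟨-, h⟩
        · simp at h
          subst h
          exact ⟨[], [], rfl, fun X Y h => by simp at h, by simp [J1, J2]⟩
        · simp at h
  | succ k ih =>
    obtain ⟨P, Q, P', Q', l, r, hR, hA1, hA2, hJ, hl, hl', rfl, rfl⟩ := h
    have I := ih (by omega) hR
    have c := I.wu.ctx hk
    have c' := I.ww.ctx hk
    have hcc : (ch N (k+1) P Q l r).count N = (ch N (k+1) P' Q' l r).count N := by
      rw [count_ch hk, count_ch hk]
      have := I.cc
      simp at this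
      omega
    refine ⟨word_child I.wu hk hl, word_child I.ww hk hl', (good1_child c).2 ⟨I.gu, hA1⟩,
      (good2_child c').2 ⟨I.gw, hA2⟩, ?_, hcc, ?_, ?_, ?_⟩
    · intro x
      rw [S1_child c hA1 hl, S2_child c' I.gw hA2 hl', hJ, hcc, I.ss]
    · intro x hx hxk
      rcases Nat.lt_or_ge x (k+1) with h | h
      · rw [opT_lt c h, opT_lt c' h]; exact I.oT x hx (by omega)
      · have : x = k + 1 := by omega
        subst this
        rw [opT_v c hl, opT_v c' hl']
    · intro x hx hxk
      rcases Nat.lt_or_ge x (k+1) with h | h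
      · rw [opA_lt c h, opA_lt c' h]; exact I.oA x hx (by omega)
      · have : x = k + 1 := by omega
        subst this
        rw [opA_v c, opA_v c']
    · intro x hx hxk
      rcases Nat.lt_or_ge x (k+1) with h | h
      · rw [opM_lt c h, opM_lt c' h]; exact I.oM x hx (by omega)
      · have : x = k + 1 := by omega
        subst this
        rw [opM_v c, opM_v c', ← J1_zero c, ← J2_zero c', hJ]

theorem R_total {N k : ℕ} (hk : k < N) {u : List ℕ} (hu : Word N k u) (hg : G1 u) :
    ∃ w, R N k u w := by
  induction k generalizing u with
  | zero => exact ⟨[N], word_zero.1 hu, rfl⟩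
  | succ k ih =>
    obtain ⟨P, Q, l, r, rfl, hw, hl⟩ := word_decomp hu hk
    have c := hw.ctx hk
    obtain ⟨hg', hA⟩ := (good1_child c).1 hg
    obtain ⟨w, hR⟩ := ih (by omega) hw hg'
    have I := R_inv (by omega) hR
    obtain ⟨P', Q', rfl, hA2, hJ⟩ := (I.ss (J1 N P Q)).1 ⟨P, Q, rfl, hA, rfl⟩
    have c' := I.ww.ctx hk
    refine ⟨_, P, Q, P', Q', l, r, hR, hA, hA2, hJ, hl, ?_, rfl, rfl⟩
    rw [← J2_zero c', ← hJ, J1_zero c]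
    exact hl

theorem R_surj {N k : ℕ} (hk : k < N) {w : List ℕ} (hu : Word N k w) (hg : G2 w) :
    ∃ u, R N k u w := by
  induction k generalizing w with
  | zero => exact ⟨[N], rfl, word_zero.1 hu⟩
  | succ k ih =>
    obtain ⟨P', Q', l, r, rfl, hw, hl⟩ := word_decomp hu hk
    have c' := hw.ctx hk
    obtain ⟨hg', hA⟩ := (good2_child c').1 hg
    obtain ⟨u, hR⟩ := ih (by omega) hw hg'
    have I := R_inv (by omega) hR
    obtain ⟨P, Q, rfl, hA2, hJ⟩ := (I.ss (J2 N P')).2 ⟨P', Q', rfl, hA, rfl⟩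
    have c := I.wu.ctx hk
    refine ⟨_, P, Q, P', Q', l, r, hR, hA2, hA, hJ.symm, ?_, hl, rfl, rfl⟩
    rw [← J1_zero c, ← hJ, J2_zero c']
    exact hl

theorem R_fun {N k : ℕ} (hk : k < N) {u w w' : List ℕ} (h : R N k u w) (h' : R N k u w') :
    w = w' := by
  induction k generalizing u w w' with
  | zero => rw [h.2, h'.2]
  | succ k ih =>
    obtain ⟨P, Q, P', Q', l, r, hR, hA1, hA2, hJ, hl, hl', rfl, rfl⟩ := h
    obtain ⟨P1, Q1, P1', Q1', l1, r1, hR1, hA11, hA21, hJ1, hl1, hl1', e, rfl⟩ := h'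
    have I := R_inv (by omega) hR
    have I1 := R_inv (by omega) hR1
    obtain ⟨rfl, rfl, rfl, rfl⟩ := ch_inj (I.wu.ctx hk) (I1.wu.ctx hk) e
    have e0 := ih (by omega) hR hR1
    obtain ⟨rfl, rfl⟩ := J2_inj e0 (by omega)
    rfl

theorem R_inj {N k : ℕ} (hk : k < N) {u u' w : List ℕ} (h : R N k u w) (h' : R N k u' w) :
    u = u' := by
  induction k generalizing u w u' with
  | zero => rw [h.1, h'.1]
  | succ k ih =>
    obtain ⟨P, Q, P', Q', l, r, hR, hA1, hA2, hJ, hl, hl', rfl, rfl⟩ := h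
    obtain ⟨P1, Q1, P1', Q1', l1, r1, hR1, hA11, hA21, hJ1, hl1, hl1', rfl, e⟩ := h'
    have I := R_inv (by omega) hR
    have I1 := R_inv (by omega) hR1
    obtain ⟨rfl, rfl, rfl, rfl⟩ := ch_inj (I.ww.ctx hk) (I1.ww.ctx hk) e
    have e0 := ih (by omega) hR hR1
    obtain ⟨rfl, rfl⟩ := J1_inj e0 (fun x hx => by
      have := (I.wu.2.2.2 x).1 hx
      omega) hA1 hA11 (by omega)
    rfl

variable {n : ℕ}

/-- Entries, 0-based positions. -/
def G (σ : Equiv.Perm (Fin n)) (i : ℕ) : ℕ := entry σ (i + 1)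

theorem G_eq (σ : Equiv.Perm (Fin n)) {i : ℕ} (h : i < n) : G σ i = (σ ⟨i, h⟩ : ℕ) + 1 := by
  simp [G, entry, h]

theorem G_inj (σ : Equiv.Perm (Fin n)) {i j : ℕ} (hi : i < n) (hj : j < n)
    (h : G σ i = G σ j) : i = j := by
  rw [G_eq σ hi, G_eq σ hj] at h
  have : σ ⟨i, hi⟩ = σ ⟨j, hj⟩ := by ext; omega
  simpa using σ.injective this

theorem G_bd (σ : Equiv.Perm (Fin n)) {i : ℕ} (hi : i < n) : 1 ≤ G σ i ∧ G σ i ≤ n := by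
  rw [G_eq σ hi]
  have := (σ ⟨i, hi⟩).2
  omega

theorem G_surj (σ : Equiv.Perm (Fin n)) {x : ℕ} (h1 : 1 ≤ x) (h2 : x ≤ n) :
    ∃ i, i < n ∧ G σ i = x := by
  refine ⟨σ.symm ⟨x - 1, by omega⟩, (σ.symm ⟨x - 1, by omega⟩).2, ?_⟩
  rw [G_eq σ (σ.symm ⟨x - 1, by omega⟩).2]
  simp
  omega

def ws (σ : Equiv.Perm (Fin n)) : List ℕ := (List.range n).map (G σ)

def wd (σ : Equiv.Perm (Fin n)) : List ℕ := (n + 1) :: ws σ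

theorem ws_length (σ : Equiv.Perm (Fin n)) : (ws σ).length = n := by simp [ws]

theorem ws_get (σ : Equiv.Perm (Fin n)) (i : ℕ) (h : i < (ws σ).length) :
    (ws σ)[i] = G σ i := by simp [ws]

theorem mem_ws (σ : Equiv.Perm (Fin n)) {x : ℕ} : x ∈ ws σ ↔ 1 ≤ x ∧ x ≤ n := by
  simp only [ws, List.mem_map, List.mem_range]
  constructor
  · rintro ⟨i, hi, rfl⟩
    exact G_bd σ hi
  · rintro ⟨h1, h2⟩
    exact G_surj σ h1 h2

theorem wd_inj {σ τ : Equiv.Perm (Fin n)} (h : wd σ = wd τ) : σ = τ := by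
  simp only [wd, List.cons.injEq, true_and] at h
  ext i
  have : G σ i = G τ i := by
    rw [← ws_get σ i (by simp [ws]), ← ws_get τ i (by simp [ws])]
    simp [h]
  rw [G_eq σ i.2, G_eq τ i.2] at this
  simpa using this

theorem wd_count (σ : Equiv.Perm (Fin n)) : (wd σ).count (n+1) = 1 := by
  have : (ws σ).count (n+1) = 0 := by
    rw [List.count_eq_zero, mem_ws]
    omega
  simp [wd, this]

theorem wd_word (σ : Equiv.Perm (Fin n)) : Word (n+1) n (wd σ) := by
  refine ⟨⟨_, rfl⟩, ?_, ?_, ?_⟩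
  · rw [wd, List.isChain_iff_getElem]
    intro i hi
    simp only [List.getElem_cons_succ, ws_get]
    rintro ⟨-, h⟩
    simp [ws] at hi
    have := G_bd σ hi
    omega
  · rw [wd, List.pairwise_cons]
    refine ⟨fun _ _ _ => rfl, ?_⟩
    rw [List.pairwise_iff_getElem]
    intro i j hi hj hij h
    rw [ws_get, ws_get] at h
    rw [ws_length] at hi hj
    have := G_inj σ hi hj h
    omega
  · intro x
    rw [wd, List.mem_cons, mem_ws]

theorem word_perm {w : List ℕ} (h : Word (n+1) n w) (hc : w.count (n+1) = 1) :
    ∃ τ : Equiv.Perm (Fin n), w = wd τ := by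
  obtain ⟨⟨t, rfl⟩, -, hp, hm⟩ := h
  simp at hc
  have hN : n + 1 ∉ t := List.count_eq_zero.1 hc
  have hmt : ∀ x, x ∈ t ↔ 1 ≤ x ∧ x ≤ n := by
    intro x
    have := hm x
    simp only [List.mem_cons] at this
    constructor
    · intro h
      have h1 := this.1 (Or.inr h)
      have : x ≠ n + 1 := by rintro rfl; exact hN h
      omega
    · intro h
      have := this.2 (Or.inr h)
      rcases this with h | h
      · omega
      · exact h
  have hnd : t.Nodup := by
    rw [List.pairwise_cons] at hp
    have h2 := hp.2
    rw [List.Nodup, List.pairwise_iff_forall_sublist] at *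
    intro a b hs hab
    have := h2 hs hab
    subst this
    exact hN (hs.subset (by simp))
  have hlen : t.length = n := by
    have : t.toFinset = Finset.Icc 1 n := by
      ext x; simp [hmt]
    rw [← List.toFinset_card_of_nodup hnd, this]
    simp
  have hg : ∀ i : Fin n, 1 ≤ t[i]'(by omega) ∧ t[i]'(by omega) ≤ n := fun i =>
    (hmt _).1 (List.getElem_mem _)
  let f : Fin n → Fin n := fun i => ⟨t[i]'(by omega) - 1, by have := hg i; omega⟩
  have hf : Function.Injective f := by
    intro i j hij
    simp only [f, Fin.mk.injEq] at hij
    have h1 := hg i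
    have h2 := hg j
    have h3 : t[i]'(by omega) = t[j]'(by omega) := by omega
    have := (List.Nodup.getElem_inj_iff hnd).1 h3
    exact Fin.ext this
  refine ⟨Equiv.ofBijective f (Finite.injective_iff_bijective.1 hf), ?_⟩
  rw [wd]
  congr 1
  apply List.ext_getElem
  · rw [ws_length, hlen]
  · intro i h1 h2
    rw [ws_get, G_eq _ (by omega)]
    have := hg ⟨i, by omega⟩
    simp [f] at this ⊢
    omega

theorem sub4_ws {σ : Equiv.Perm (Fin n)} {b c a d : ℕ} :
    [b, c, a, d].Sublist (ws σ) ↔ ∃ f : Fin 4 → Fin n, StrictMono f ∧ b = G σ (f 0) ∧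
      c = G σ (f 1) ∧ a = G σ (f 2) ∧ d = G σ (f 3) := by
  rw [List.sublist_iff_exists_fin_orderEmbedding_get_eq]
  constructor
  · rintro ⟨f, hf⟩
    refine ⟨fun i => Fin.cast (ws_length σ) (f i), ?_, ?_, ?_, ?_, ?_⟩
    · intro i j hij
      exact f.strictMono hij
    · exact (hf 0).trans (ws_get σ _ _)
    · exact (hf 1).trans (ws_get σ _ _)
    · exact (hf 2).trans (ws_get σ _ _)
    · exact (hf 3).trans (ws_get σ _ _)
  · rintro ⟨f, hf, rfl, rfl, rfl, rfl⟩
    refine ⟨OrderEmbedding.ofStrictMono (fun i => Fin.cast (ws_length σ).symm (f i)) ?_, ?_⟩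
    · intro i j hij
      exact hf hij
    · intro i
      change Fin 4 at i
      fin_cases i <;> simp [ws] <;> rfl

theorem sub_wd {σ : Equiv.Perm (Fin n)} {b c a d : ℕ} (h : [b, c, a, d].Sublist (wd σ))
    (hb : b < c ∨ b < d) : [b, c, a, d].Sublist (ws σ) := by
  have m := mem_of_sub h (Z := fun x => x ≤ n + 1) (fun x hx => by
    have := ((wd_word σ).2.2.2 x).1 hx; omega)
  rw [wd, sub_cons4] at h
  simp at m
  rcases h with h | h
  · omega
  · exact h

theorem G_lt {σ : Equiv.Perm (Fin n)} (i j : Fin n) : G σ i < G σ j ↔ σ i < σ j := by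
  rw [G_eq σ i.2, G_eq σ j.2]
  simp

theorem G1_wd (σ : Equiv.Perm (Fin n)) :
    G1 (wd σ) ↔ AvoidsPat (![1, 3, 0, 2] : Fin 4 → Fin 4) σ := by
  unfold AvoidsPat Contains G1
  constructor
  · rintro h ⟨f, hf, hp⟩
    refine h (G σ (f 2)) (G σ (f 0)) (G σ (f 1)) (G σ (f 3)) ?_ ?_
    · exact (sub4_ws.2 ⟨f, hf, rfl, rfl, rfl, rfl⟩).trans (List.sublist_cons_self _ _)
    · simp only [G_lt, ← hp]
      decide
  · rintro h a b c d hs hlt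
    obtain ⟨f, hf, rfl, rfl, rfl, rfl⟩ := sub4_ws.1 (sub_wd hs (by omega))
    refine h ⟨f, hf, ?_⟩
    simp only [G_lt, Fin.lt_def] at hlt
    intro i j
    simp only [Fin.lt_def]
    fin_cases i <;> fin_cases j <;> simp <;> omega

theorem G2_wd (σ : Equiv.Perm (Fin n)) :
    G2 (wd σ) ↔ AvoidsPat (![1, 2, 0, 3] : Fin 4 → Fin 4) σ := by
  unfold AvoidsPat Contains G2
  constructor
  · rintro h ⟨f, hf, hp⟩
    refine h (G σ (f 2)) (G σ (f 0)) (G σ (f 1)) (G σ (f 3)) ?_ ?_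
    · exact (sub4_ws.2 ⟨f, hf, rfl, rfl, rfl, rfl⟩).trans (List.sublist_cons_self _ _)
    · simp only [G_lt, ← hp]
      decide
  · rintro h a b c d hs hlt
    obtain ⟨f, hf, rfl, rfl, rfl, rfl⟩ := sub4_ws.1 (sub_wd hs (by omega))
    refine h ⟨f, hf, ?_⟩
    simp only [G_lt, Fin.lt_def] at hlt
    intro i j
    simp only [Fin.lt_def]
    fin_cases i <;> fin_cases j <;> simp <;> omega

theorem opT_wd (σ : Equiv.Perm (Fin n)) {x : ℕ} (hx : x ≤ n) :
    opT x (wd σ) ↔ ∃ i, i + 1 < n ∧ G σ i < x ∧ G σ (i + 1) = x := by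
  unfold opT wd
  rw [List.isChain_cons, List.isChain_iff_getElem]
  simp only [ws_get, ws_length]
  have h0 : (∀ y ∈ (ws σ).head?, y = x → x ≤ n + 1) := fun _ _ _ => by omega
  constructor
  · intro h
    by_contra hcon
    push Not at hcon
    refine h ⟨h0, fun i hi e => ?_⟩
    by_contra hlt
    exact hcon i hi (by omega) e
  · rintro ⟨i, hi, h1, h2⟩ ⟨-, h⟩
    have := h i hi h2
    omega

theorem opA_wd (σ : Equiv.Perm (Fin n)) {x : ℕ} (hx : x ≤ n) :
    opA x (wd σ) ↔ ∃ i, i + 1 < n ∧ x < G σ (i + 1) ∧ G σ i = x := by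
  unfold opA wd
  rw [List.isChain_cons, List.isChain_iff_getElem]
  simp only [ws_get, ws_length]
  have h0 : (∀ y ∈ (ws σ).head?, n + 1 = x → y ≤ x) := fun _ _ _ => by omega
  constructor
  · intro h
    by_contra hcon
    push Not at hcon
    refine h ⟨h0, fun i hi e => ?_⟩
    by_contra hlt
    exact hcon i hi (by omega) e
  · rintro ⟨i, hi, h1, h2⟩ ⟨-, h⟩
    have := h i hi h2
    omega

theorem opM_wd (σ : Equiv.Perm (Fin n)) {i : ℕ} (hi : i < n) :
    opM (G σ i) (wd σ) ↔ ∀ j, j < i → G σ i < G σ j := by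
  unfold opM wd
  rw [List.pairwise_cons, List.pairwise_iff_getElem]
  simp only [ws_get, ws_length]
  constructor
  · rintro ⟨-, h⟩ j hj
    exact h j i (by omega) hi hj rfl
  · intro h
    refine ⟨fun _ _ _ => by have := G_bd σ hi; omega, ?_⟩
    intro a b ha hb hab e
    have := G_inj σ hb hi e
    subst this
    exact h a hab

theorem mem_Asctop (σ : Equiv.Perm (Fin n)) {x : ℕ} :
    x ∈ Asctop σ ↔ (1 ≤ x ∧ x ≤ n) ∧ opT x (wd σ) := by
  simp only [Asctop, Asc, Finset.mem_image, Finset.mem_filter, Finset.mem_Icc]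
  constructor
  · rintro ⟨i, ⟨⟨h1, h2⟩, h3⟩, rfl⟩
    obtain ⟨i, rfl⟩ : ∃ j, i = j + 1 := ⟨i - 1, by omega⟩
    have hb := G_bd σ (i := i + 1) (by omega)
    refine ⟨hb, ?_⟩
    change opT (G σ (i+1)) _
    rw [opT_wd σ hb.2]
    exact ⟨i, by omega, h3, rfl⟩
  · rintro ⟨⟨h1, h2⟩, h⟩
    rw [opT_wd σ h2] at h
    obtain ⟨i, hi, h3, rfl⟩ := h
    exact ⟨i + 1, ⟨by omega, h3⟩, rfl⟩

theorem mem_Ascbot (σ : Equiv.Perm (Fin n)) {x : ℕ} :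
    x ∈ Ascbot σ ↔ (1 ≤ x ∧ x ≤ n) ∧ opA x (wd σ) := by
  simp only [Ascbot, Asc, Finset.mem_image, Finset.mem_filter, Finset.mem_Icc]
  constructor
  · rintro ⟨i, ⟨⟨h1, h2⟩, h3⟩, rfl⟩
    obtain ⟨i, rfl⟩ : ∃ j, i = j + 1 := ⟨i - 1, by omega⟩
    have hb := G_bd σ (i := i) (by omega)
    refine ⟨hb, ?_⟩
    change opA (G σ i) _
    rw [opA_wd σ hb.2]
    exact ⟨i, by omega, h3, rfl⟩
  · rintro ⟨⟨h1, h2⟩, h⟩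
    rw [opA_wd σ h2] at h
    obtain ⟨i, hi, h3, rfl⟩ := h
    exact ⟨i + 1, ⟨by omega, h3⟩, rfl⟩

theorem mem_LRmin (σ : Equiv.Perm (Fin n)) {x : ℕ} :
    x ∈ LRmin σ ↔ (1 ≤ x ∧ x ≤ n) ∧ opM x (wd σ) := by
  simp only [LRmin, Finset.mem_image, Finset.mem_filter, Finset.mem_Icc]
  constructor
  · rintro ⟨i, ⟨⟨h1, h2⟩, h3⟩, rfl⟩
    obtain ⟨i, rfl⟩ : ∃ j, i = j + 1 := ⟨i - 1, by omega⟩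
    have hb := G_bd σ (i := i) (by omega)
    refine ⟨hb, ?_⟩
    change opM (G σ i) _
    rw [opM_wd σ (by omega)]
    intro j hj
    exact h3 (j + 1) (by omega) (by omega)
  · rintro ⟨⟨h1, h2⟩, h⟩
    obtain ⟨i, hi, rfl⟩ := G_surj σ h1 h2
    rw [opM_wd σ hi] at h
    refine ⟨i + 1, ⟨by omega, ?_⟩, rfl⟩
    intro j hj1 hj2
    have := h (j - 1) (by omega)
    unfold G at this
    rwa [Nat.sub_add_cancel hj1] at this

theorem mem_Desbot (σ : Equiv.Perm (Fin n)) {x : ℕ} :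
    x ∈ Desbot σ ↔ (1 ≤ x ∧ x ≤ n) ∧ x ∉ Asctop σ ∧
      ¬ (x ∈ LRmin σ ∧ ∀ y ∈ LRmin σ, y ≤ x) := by
  constructor
  · intro h
    simp only [Desbot, Des, Finset.mem_image, Finset.mem_filter, Finset.mem_Icc] at h
    obtain ⟨i, ⟨⟨h1, h2⟩, h3⟩, rfl⟩ := h
    obtain ⟨i, rfl⟩ : ∃ j, i = j + 1 := ⟨i - 1, by omega⟩
    have hb := G_bd σ (i := i + 1) (by omega)
    change G σ (i + 1) < G σ i at h3
    change (1 ≤ G σ (i + 1) ∧ G σ (i + 1) ≤ n) ∧ G σ (i + 1) ∉ _ ∧ ¬ (G σ (i + 1) ∈ _ ∧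
      ∀ y ∈ _, y ≤ G σ (i + 1))
    refine ⟨hb, ?_, ?_⟩
    · rw [mem_Asctop, opT_wd σ hb.2]
      rintro ⟨-, j, hj, hlt, he⟩
      have := G_inj σ hj (by omega) he
      have : j = i := by omega
      subst this
      omega
    · rintro ⟨hm, hy⟩
      rw [mem_LRmin, opM_wd σ (by omega)] at hm
      have h0 := hm.2 0 (by omega)
      have := hy (G σ 0) (by
        rw [mem_LRmin, opM_wd σ (by omega)]
        exact ⟨G_bd σ (by omega), fun j hj => by omega⟩)
      omega
  · rintro ⟨⟨h1, h2⟩, h3, h4⟩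
    obtain ⟨i, hi, rfl⟩ := G_surj σ h1 h2
    rcases i with _ | i
    · exfalso
      apply h4
      refine ⟨?_, ?_⟩
      · rw [mem_LRmin, opM_wd σ (by omega)]
        exact ⟨G_bd σ (by omega), fun j hj => by omega⟩
      · intro y hy
        rw [mem_LRmin] at hy
        obtain ⟨j, hj, rfl⟩ := G_surj σ hy.1.1 hy.1.2
        rw [opM_wd σ hj] at hy
        rcases Nat.eq_zero_or_pos j with rfl | hp
        · exact le_rfl
        · exact (hy.2 0 hp).le
    · simp only [Desbot, Des, Finset.mem_image, Finset.mem_filter, Finset.mem_Icc]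
      refine ⟨i + 1, ⟨by omega, ?_⟩, rfl⟩
      change G σ (i + 1) < G σ i
      rw [mem_Asctop, opT_wd σ h2] at h3
      by_contra hcon
      have hne : G σ i ≠ G σ (i + 1) := fun e => by
        have := G_inj σ (by omega) hi e
        omega
      exact h3 ⟨⟨h1, h2⟩, i, hi, by omega, rfl⟩

theorem stats_eq {σ τ : Equiv.Perm (Fin n)} (I : Inv (n+1) n (wd σ) (wd τ)) :
    Desbot σ = Desbot τ ∧ Asctop σ = Asctop τ ∧ Ascbot σ = Ascbot τ ∧ Val σ = Val τ ∧
      LRmin σ = LRmin τ := by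
  have hT : Asctop σ = Asctop τ := by
    ext x
    rw [mem_Asctop, mem_Asctop]
    exact and_congr_right (fun h => I.oT x h.1 h.2)
  have hA : Ascbot σ = Ascbot τ := by
    ext x
    rw [mem_Ascbot, mem_Ascbot]
    exact and_congr_right (fun h => I.oA x h.1 h.2)
  have hM : LRmin σ = LRmin τ := by
    ext x
    rw [mem_LRmin, mem_LRmin]
    exact and_congr_right (fun h => I.oM x h.1 h.2)
  have hD : Desbot σ = Desbot τ := by
    ext x
    rw [mem_Desbot, mem_Desbot, hT, hM]
  exact ⟨hD, hT, hA, by rw [Val, Val, hD, hA], hM⟩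

theorem exists_right (σ : Equiv.Perm (Fin n))
    (h : AvoidsPat (![1, 3, 0, 2] : Fin 4 → Fin 4) σ) :
    ∃ τ : Equiv.Perm (Fin n), R (n+1) n (wd σ) (wd τ) := by
  obtain ⟨w, hR⟩ := R_total (Nat.lt_succ_self n) (wd_word σ) ((G1_wd σ).2 h)
  have I := R_inv (Nat.lt_succ_self n) hR
  obtain ⟨τ, rfl⟩ := word_perm I.ww (by rw [← I.cc]; exact wd_count σ)
  exact ⟨τ, hR⟩

theorem exists_left (τ : Equiv.Perm (Fin n))
    (h : AvoidsPat (![1, 2, 0, 3] : Fin 4 → Fin 4) τ) :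
    ∃ σ : Equiv.Perm (Fin n), R (n+1) n (wd σ) (wd τ) := by
  obtain ⟨u, hR⟩ := R_surj (Nat.lt_succ_self n) (wd_word τ) ((G2_wd τ).2 h)
  have I := R_inv (Nat.lt_succ_self n) hR
  obtain ⟨σ, rfl⟩ := word_perm I.wu (by rw [I.cc]; exact wd_count τ)
  exact ⟨σ, hR⟩

end WilfProof

/-- The patterns 2413 and 2314 are
`(Desbot, Asctop, Ascbot, Val, LRmin)`-Wilf equivalent. -/
theorem wilf_2413_2314 (n : ℕ) (B At Ab V L : Finset ℕ)
    (hB : B ⊆ Finset.Icc 1 n) (hAt : At ⊆ Finset.Icc 1 n) (hAb : Ab ⊆ Finset.Icc 1 n)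
    (hV : V ⊆ Finset.Icc 1 n) (hL : L ⊆ Finset.Icc 1 n) :
    ((Finset.univ : Finset (Equiv.Perm (Fin n))).filter
        (fun σ => AvoidsPat (![1, 3, 0, 2] : Fin 4 → Fin 4) σ ∧ Desbot σ = B ∧
          Asctop σ = At ∧ Ascbot σ = Ab ∧ Val σ = V ∧ LRmin σ = L)).card =
      ((Finset.univ : Finset (Equiv.Perm (Fin n))).filter
        (fun σ => AvoidsPat (![1, 2, 0, 3] : Fin 4 → Fin 4) σ ∧ Desbot σ = B ∧
          Asctop σ = At ∧ Ascbot σ = Ab ∧ Val σ = V ∧ LRmin σ = L)).card := by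
  have hn := Nat.lt_succ_self n
  choose! f hf using (WilfProof.exists_right (n := n))
  apply Finset.card_bij (fun σ _ => f σ)
  · intro σ hσ
    simp only [Finset.mem_filter, Finset.mem_univ, true_and] at hσ ⊢
    have I := WilfProof.R_inv hn (hf σ hσ.1)
    have hs := WilfProof.stats_eq I
    refine ⟨(WilfProof.G2_wd _).1 I.gw, ?_⟩
    rw [← hs.1, ← hs.2.1, ← hs.2.2.1, ← hs.2.2.2.1, ← hs.2.2.2.2]
    exact hσ.2
  · intro σ hσ τ hτ e
    simp only [Finset.mem_filter, Finset.mem_univ, true_and] at hσ hτ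
    have h1 := hf σ hσ.1
    have h2 := hf τ hτ.1
    rw [← e] at h2
    exact WilfProof.wd_inj (WilfProof.R_inj hn h1 h2)
  · intro τ hτ
    simp only [Finset.mem_filter, Finset.mem_univ, true_and] at hτ
    obtain ⟨σ, hR⟩ := WilfProof.exists_left τ hτ.1
    have I := WilfProof.R_inv hn hR
    have hs := WilfProof.stats_eq I
    have hav := (WilfProof.G1_wd _).1 I.gu
    refine ⟨σ, ?_, WilfProof.wd_inj (WilfProof.R_fun hn (hf σ hav) hR)⟩
    simp only [Finset.mem_filter, Finset.mem_univ, true_and]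
    refine ⟨hav, ?_⟩
    rw [hs.1, hs.2.1, hs.2.2.1, hs.2.2.2.1, hs.2.2.2.2]
    exact hτ.2
end

section
/- The patterns 3142 and 3241 are (Destop, Desbot, Asctop, Peak, LRmax)-Wilf equivalent: for every n ≥ 0 and all sets T, B, A, P, L ⊆ [n], the number of permutations σ ∈ Av_n(3142) with Destop(σ) = T, Desbot(σ) = B, Asctop(σ) = A, Peak(σ) = P, and LRmax(σ) = L equals the number of permutations σ ∈ Av_n(3241) with the same five set values. -/
open scoped Classical

namespace W

theorem split2 {α : Type*} {X Y P S : List α} {a b : α} (h : X ++ a :: Y = P ++ b :: S) :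
    (X = P ∧ a = b ∧ Y = S) ∨ (∃ z, P = X ++ a :: z ∧ Y = z ++ b :: S) ∨
      (∃ z, X = P ++ b :: z ∧ S = z ++ a :: Y) := by
  rcases List.append_eq_append_iff.1 h with ⟨t, h1, h2⟩ | ⟨t, h1, h2⟩
  · cases t with
    | nil => simp at h1 h2; left; simp_all
    | cons c t => simp at h2; right; left; exact ⟨t, by simp [h1, h2.1], h2.2⟩
  · cases t with
    | nil => simp at h1 h2; left; simp_all
    | cons c t => simp at h2; right; right; exact ⟨t, by simp [h1, h2.1], h2.2⟩

def ok (x : List ℕ) (c : ℕ) : Bool := decide (∀ a ∈ x, a ≠ 0 → c ≤ a)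

theorem ok_iff (x : List ℕ) (c : ℕ) : ok x c = true ↔ ∀ a ∈ x, a ≠ 0 → c ≤ a := by simp [ok]

def ht (x y : List ℕ) : ℕ := (y.takeWhile (ok x)).count 0

theorem ht_all {x z : List ℕ} (y : List ℕ) (h : ∀ c ∈ z, ok x c = true) :
    ht x (z ++ y) = z.count 0 + ht x y := by
  unfold ht
  rw [List.takeWhile_append_of_pos h, List.count_append]

theorem ht_not {x z : List ℕ} (y : List ℕ) (h : ¬ ∀ c ∈ z, ok x c = true) :
    ht x (z ++ y) = ht x z := by
  unfold ht
  induction z with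
  | nil => simp at h
  | cons c z ih =>
    by_cases hc : ok x c = true
    · simp only [List.cons_append, List.takeWhile_cons, hc, if_true, List.count_cons]
      rw [ih]
      intro h'; apply h; simpa [hc] using h'
    · simp [hc]

theorem ht_le (x y : List ℕ) : ht x y ≤ y.count 0 :=
  (List.takeWhile_prefix _).sublist.count_le _

theorem ok_zero (x : List ℕ) : ok x 0 = true := by simp [ok]

theorem ht_zero_cons (x y : List ℕ) : ht x (0 :: y) = ht x y + 1 := by
  simp [ht, ok_zero]

theorem ok_mono {x x' : List ℕ} (h : ∀ a ∈ x, a ∈ x') {c : ℕ} (hc : ok x' c = true) :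
    ok x c = true := by
  rw [ok_iff] at *
  exact fun a ha => hc a (h a ha)

theorem ht_mono {x x' : List ℕ} (h : ∀ a ∈ x, a ∈ x') (y : List ℕ) : ht x' y ≤ ht x y := by
  induction y with
  | nil => simp [ht]
  | cons c y ih =>
    by_cases hc : ok x' c = true
    · have := ok_mono h hc
      simp only [ht, List.takeWhile_cons, hc, this, if_true, List.count_cons] at *
      omega
    · simp [ht, hc]

theorem ht_nil (y : List ℕ) : ht [] y = y.count 0 := by
  have := ht_all (x := []) (z := y) [] (by simp [ok])
  simpa [ht] using this

/-- key monotonicity -/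
theorem ht_lt {x z y : List ℕ} (h : ∀ c ∈ z, ok x c = true) :
    ht (x ++ 0 :: z) y < ht x (z ++ 0 :: y) := by
  rw [ht_all _ h, ht_zero_cons]
  have := ht_mono (x := x) (x' := x ++ 0 :: z) (by simp +contextual) y
  omega

/-- no two adjacent zeros -/
def NA (w : List ℕ) : Prop := ∀ p s, w ≠ p ++ 0 :: 0 :: s

theorem NA.head {x y : List ℕ} (h : NA (x ++ 0 :: y)) : ∀ s, y ≠ 0 :: s := by
  rintro s rfl; exact h x s rfl

/-- positive height: a first small nonzero element, then a zero -/
theorem ht_pos {x y : List ℕ} (hna : NA (x ++ 0 :: y)) (h : ht x y ≠ 0) :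
    ∃ e t, y = e :: t ∧ e ≠ 0 ∧ ok x e = true ∧ 0 ∈ t := by
  cases y with
  | nil => simp [ht] at h
  | cons e t =>
    have he : e ≠ 0 := by rintro rfl; exact hna x t rfl
    refine ⟨e, t, rfl, he, ?_, ?_⟩
    · by_contra hc; simp [ht, hc] at h
    · by_contra hc
      apply h
      have := ht_le x (e :: t)
      rw [List.count_eq_zero.2] at this
      · omega
      · simp [hc, he.symm]

def st (w : List ℕ) : Set ℕ := {h | ∃ x y, w = x ++ 0 :: y ∧ ht x y = h}

theorem last_zero {w : List ℕ} (h : 0 ∈ w) : ∃ x y, w = x ++ 0 :: y ∧ 0 ∉ y := by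
  induction w with
  | nil => simp at h
  | cons c w ih =>
    by_cases h0 : 0 ∈ w
    · obtain ⟨x, y, h1, h2⟩ := ih h0
      exact ⟨c :: x, y, by simp [h1], h2⟩
    · have : c = 0 := by simp [h0] at h; exact h.symm
      exact ⟨[], w, by simp [this], h0⟩

theorem zero_mem_st {w : List ℕ} (h : 0 ∈ w) : 0 ∈ st w := by
  obtain ⟨x, y, h1, h2⟩ := last_zero h
  refine ⟨x, y, h1, ?_⟩
  have := ht_le x y
  rw [List.count_eq_zero.2 h2] at this; omega

def lf (u : ℕ) (B : Finset ℕ) : List ℕ := if u ∈ B then [] else [0]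

def rg (u : ℕ) (T : Finset ℕ) : List ℕ := if u ∈ T then [0] else []

def child (T B : Finset ℕ) (u : ℕ) (x y : List ℕ) : List ℕ :=
  (x ++ lf u B) ++ u :: (rg u T ++ y)

end W

namespace W

def tr (T B : Finset ℕ) (u : ℕ) (H : Set ℕ) (h : ℕ) : Set ℕ :=
  {k | k = 0 ∨ ∃ h' ∈ H, (h < h' ∨ (u ∉ B ∧ h' = h)) ∧
    k + 1 = h' + (lf u B).length + (rg u T).length}

theorem ht_mid (T B : Finset ℕ) {u : ℕ} (hu : u ≠ 0) {X z y : List ℕ}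
    (hX : ok X u = true) (hz : ∀ c ∈ z, ok X c = true) :
    ht X (z ++ lf u B ++ u :: (rg u T ++ y)) + 1 =
      ht X (z ++ 0 :: y) + (lf u B).length + (rg u T).length := by
  rw [ht_all _ hz, ht_zero_cons, List.append_assoc, ht_all _ hz]
  have e1 : ∀ l, ht X (u :: l) = ht X l := by
    intro l
    simp [ht, hX, hu]
  by_cases h1 : u ∈ B <;> by_cases h2 : u ∈ T <;>
    simp [lf, rg, h1, h2, ht_zero_cons, e1] <;> omega

theorem st_child (T B : Finset ℕ) {u : ℕ} (hu : u ≠ 0) {x y : List ℕ}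
    (hmin : ∀ a ∈ x ++ y, a ≠ 0 → u < a)
    (hna : NA (child T B u x y)) (h0 : 0 ∈ child T B u x y)
    (S1 : ∀ x1 z, x = x1 ++ 0 :: z → (∀ c ∈ z, ok x1 c = true) ∨ ht x1 (z ++ 0 :: y) = 0)
    (S2 : ∀ z y2, y = z ++ 0 :: y2 → ht (x ++ 0 :: z) y2 < ht x y ∨ ht (x ++ 0 :: z) y2 = 0) :
    st (child T B u x y) = tr T B u (st (x ++ 0 :: y)) (ht x y) := by
  have okx : ∀ X : List ℕ, (∀ a ∈ X, a ∈ x) → ok X u = true := by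
    intro X hX
    rw [ok_iff]
    intro a ha ha0
    exact (hmin a (by simp [hX a ha]) ha0).le
  have key : ∀ X z, x = X ++ 0 :: z →
      ht X (z ++ lf u B ++ u :: (rg u T ++ y)) ∈ tr T B u (st (x ++ 0 :: y)) (ht x y) := by
    intro X z hx
    by_cases hz : ∀ c ∈ z, ok X c = true
    · right
      refine ⟨ht X (z ++ 0 :: y), ⟨X, z ++ 0 :: y, by simp [hx], rfl⟩, Or.inl ?_, ?_⟩
      · rw [hx]; exact ht_lt hz
      · exact ht_mid T B hu (okx X (by simp +contextual [hx])) hz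
    · left
      have := (S1 X z hx).resolve_left hz
      rw [ht_not _ hz] at this
      rw [List.append_assoc, ht_not _ hz, this]
  ext k
  constructor
  · rintro ⟨X, Y, hXY, rfl⟩
    have hXY' := hXY
    rw [child] at hXY'
    rcases split2 hXY'.symm with ⟨_, h, _⟩ | ⟨z, h1, h2⟩ | ⟨z, h1, h2⟩
    · exact absurd h.symm hu
    · by_cases hB : u ∈ B
      · simp [lf, hB] at h1
        rw [h2]
        have := key X z h1
        simpa [lf, hB] using this
      · simp [lf, hB] at h1
        rcases List.eq_nil_or_concat z with rfl | ⟨z', b, rfl⟩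
        · have hx : x = X := by simpa using h1
          subst hx
          subst h2
          right
          refine ⟨ht x y, ⟨x, y, rfl, rfl⟩, Or.inr ⟨hB, rfl⟩, ?_⟩
          have := ht_mid T B (y := y) (z := []) hu (okx x (by simp)) (by simp)
          simp [ht_zero_cons, lf, hB] at this ⊢
          omega
        · have h3 : x ++ [0] = (X ++ 0 :: z') ++ [b] := by simpa using h1
          obtain ⟨h4, h5⟩ := List.append_inj' h3 rfl
          have h5 : b = 0 := by simpa using h5.symm
          subst h5 h2
          have := key X z' h4
          simpa [lf, hB] using this
    · left
      rw [hXY] at hna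
      by_contra hne
      obtain ⟨e, t, rfl, he, hok, _⟩ := ht_pos hna hne
      rw [ok_iff] at hok
      have h6 := hok u (by simp [h1]) hu
      have h7 : e ∈ rg u T ++ y := by rw [h2]; simp
      have h8 : e ∈ y := by
        rcases List.mem_append.1 h7 with h | h
        · by_cases hT : u ∈ T <;> simp [rg, hT] at h
          exact absurd h he
        · exact h
      have := hmin e (by simp [h8]) he
      omega
  · rintro (rfl | ⟨h', ⟨X, Y, hXY, rfl⟩, h, hk⟩)
    · exact zero_mem_st h0
    · rcases h with h | ⟨hB, h⟩
      · rcases split2 hXY with ⟨rfl, -, rfl⟩ | ⟨z, h1, h2⟩ | ⟨z, h1, h2⟩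
        · omega
        · exfalso
          subst h1 h2
          rcases S2 z Y rfl with h5 | h5 <;> omega
        · subst h1 h2
          rcases S1 X z rfl with h5 | h5
          · refine ⟨X, z ++ lf u B ++ u :: (rg u T ++ y), by simp [child], ?_⟩
            have := ht_mid T B (y := y) hu (okx X (by simp +contextual)) h5
            omega
          · omega
      · refine ⟨x, u :: (rg u T ++ y), by simp [child, lf, hB], ?_⟩
        have := ht_mid T B (y := y) (z := []) hu (okx x (by simp)) (by simp)
        simp [ht_zero_cons, lf, hB] at this hk
        omega

end W

namespace W

structure Spec (Av : List ℕ → Prop) (good : List ℕ → List ℕ → Prop) : Prop where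
  child_iff : ∀ (T B : Finset ℕ) (u : ℕ) (x y : List ℕ), u ≠ 0 →
    (∀ a ∈ x ++ y, a ≠ 0 → u < a) →
    (Av (child T B u x y) ↔ Av (x ++ 0 :: y) ∧ good x y)
  base : Av [0]
  ex : ∀ w, Av w → NA w → ∀ h ∈ st w, ∃ x y, w = x ++ 0 :: y ∧ good x y ∧ ht x y = h
  uniq : ∀ x z y, good x (z ++ 0 :: y) → good (x ++ 0 :: z) y →
    ht x (z ++ 0 :: y) ≠ ht (x ++ 0 :: z) y
  S1 : ∀ x y, Av (x ++ 0 :: y) → NA (x ++ 0 :: y) → good x y →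
    ∀ x1 z, x = x1 ++ 0 :: z → (∀ c ∈ z, ok x1 c = true) ∨ ht x1 (z ++ 0 :: y) = 0
  S2 : ∀ x y, Av (x ++ 0 :: y) → NA (x ++ 0 :: y) → good x y →
    ∀ z y2, y = z ++ 0 :: y2 → ht (x ++ 0 :: z) y2 < ht x y ∨ ht (x ++ 0 :: z) y2 = 0
  good_nil : ∀ y, good [] y

def Av1 (w : List ℕ) : Prop :=
  ∀ a b c d, [a, b, c, d].Sublist w → b < d → d ≤ a → a < c → False

def Av2 (w : List ℕ) : Prop :=
  ∀ a b c d, [a, b, c, d].Sublist w → d < b → b ≤ a → a < c → False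

def good1 (x _y : List ℕ) : Prop :=
  ∀ a c, [a, 0, c].Sublist x → 0 < a → a < c → False

def good2 (x y : List ℕ) : Prop :=
  ∀ a c, a ∈ x → [c, 0].Sublist y → 0 < a → a < c → False

theorem child_sub (T B : Finset ℕ) (u : ℕ) (x y : List ℕ) :
    (child T B u x y).Sublist (x ++ 0 :: u :: 0 :: y) := by
  unfold child lf rg
  rw [List.append_assoc]
  refine List.Sublist.append (List.Sublist.refl _) ?_
  split_ifs <;> simp

theorem sub_child (T B : Finset ℕ) (u : ℕ) (x y : List ℕ) :
    (x ++ u :: y).Sublist (child T B u x y) := by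
  unfold child lf rg
  rw [List.append_assoc]
  refine List.Sublist.append (List.Sublist.refl _) ?_
  split_ifs <;> simp

theorem sub_cases4 {a b c d : ℕ} {x y : List ℕ} (h : [a, b, c, d].Sublist (x ++ y)) :
    [a, b, c, d].Sublist y ∨ ([a].Sublist x ∧ [b, c, d].Sublist y) ∨
    ([a, b].Sublist x ∧ [c, d].Sublist y) ∨ ([a, b, c].Sublist x ∧ [d].Sublist y) ∨
    [a, b, c, d].Sublist x := by
  rw [List.sublist_append_iff] at h
  obtain ⟨l1, l2, h, h1, h2⟩ := h
  rcases l1 with _ | ⟨a', _ | ⟨b', _ | ⟨c', _ | ⟨d', l1⟩⟩⟩⟩ <;> simp at h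
  · subst h; simp [h2]
  · obtain ⟨rfl, rfl⟩ := h; exact Or.inr (Or.inl ⟨h1, h2⟩)
  · obtain ⟨rfl, rfl, rfl⟩ := h; exact Or.inr (Or.inr (Or.inl ⟨h1, h2⟩))
  · obtain ⟨rfl, rfl, rfl, rfl⟩ := h; exact Or.inr (Or.inr (Or.inr (Or.inl ⟨h1, h2⟩)))
  · obtain ⟨rfl, rfl, rfl, rfl, rfl, rfl⟩ := h
    exact Or.inr (Or.inr (Or.inr (Or.inr h1)))

theorem app {α : Type*} {l1 l2 l x y : List α} (h1 : l1.Sublist x) (h2 : l2.Sublist y)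
    (h : l = l1 ++ l2) : l.Sublist (x ++ y) := h ▸ h1.append h2

theorem mem_of1 {a : ℕ} {x l : List ℕ} (h : l.Sublist x) (ha : a ∈ l) : a ∈ x := h.subset ha

theorem drop_u {y l : List ℕ} {v : ℕ} (h : l.Sublist (v :: y))
    (h0 : ∀ e ∈ l.head?, e ≠ v) : l.Sublist y := by
  cases h with
  | cons _ h => exact h
  | cons_cons _ h => simp at h0

theorem child1 (T B : Finset ℕ) (u : ℕ) (x y : List ℕ) (hu : u ≠ 0)
    (hmin : ∀ a ∈ x ++ y, a ≠ 0 → u < a) :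
    Av1 (child T B u x y) ↔ Av1 (x ++ 0 :: y) ∧ good1 x y := by
  have hx : ∀ a ∈ x, a ≠ 0 → u < a := fun a ha => hmin a (by simp [ha])
  have hy : ∀ a ∈ y, a ≠ 0 → u < a := fun a ha => hmin a (by simp [ha])
  constructor
  · intro h
    have h' : Av1 (x ++ u :: y) := fun a b c d hs => h a b c d (hs.trans (sub_child T B u x y))
    constructor
    · intro a b c d hs h1 h2 h3
      rcases sub_cases4 hs with hs | ⟨s1, s2⟩ | ⟨s1, s2⟩ | ⟨s1, s2⟩ | hs
      · exact h' a b c d (app (List.nil_sublist _) (List.Sublist.cons _ (drop_u hs (by simp; omega))) rfl) h1 h2 h3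
      · by_cases hb : b = 0
        · subst hb
          have s3 : [c, d].Sublist y := by simpa using s2
          refine h' a u c d (app s1 (List.Sublist.cons_cons _ s3) rfl) ?_ h2 h3
          exact hy d (s3.subset (by simp)) (by omega)
        · exact h' a b c d (app s1 (List.Sublist.cons _ (drop_u s2 (by simp; omega))) rfl) h1 h2 h3
      · exact h' a b c d (app s1 (List.Sublist.cons _ (drop_u s2 (by simp; omega))) rfl) h1 h2 h3
      · exact h' a b c d (app s1 (List.Sublist.cons _ (drop_u s2 (by simp; omega))) rfl) h1 h2 h3
      · exact h' a b c d (app hs (List.nil_sublist _) (by simp)) h1 h2 h3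
    · intro a c hs h1 h2
      refine h' a 0 c u (app hs (by simp) rfl) (by omega) ?_ h2
      exact (hx a (hs.subset (by simp)) (by omega)).le
  · rintro ⟨h, hg⟩ a b c d hs h1 h2 h3
    have hs := hs.trans (child_sub T B u x y)
    rcases sub_cases4 hs with hs | ⟨s1, s2⟩ | ⟨s1, s2⟩ | ⟨s1, s2⟩ | hs
    · -- all in 0::u::0::y
      have s1 := drop_u hs (by simp; omega)
      have au : a ≠ u := by
        rintro rfl
        have : [b,c,d].Sublist (0 :: y) := by simpa using s1
        have hd : d ∈ 0 :: y := this.subset (by simp)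
        simp at hd
        have := hy d (hd.resolve_left (by omega)) (by omega)
        omega
      have s2 := drop_u s1 (by simp; omega)
      exact h a b c d (app (List.nil_sublist _) s2 rfl) h1 h2 h3
    · have hd : c ≠ 0 ∧ d ≠ 0 := by omega
      have hcu : u < c ∧ u < d := by
        have ha := hx a (by simpa using s1) (by omega)
        refine ⟨by omega, ?_⟩
        have hd' : [c, d].Sublist (u :: 0 :: y) := by
          cases s2 with
          | cons _ h => exact (List.sublist_cons_self b [c,d]).trans h
          | cons_cons _ h => exact h
        have hd'' := drop_u (drop_u hd' (by simp; omega)) (by simp; omega)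
        exact hy d (hd''.subset (by simp)) (by omega)
      by_cases hb : b = 0 ∨ b = u
      · refine h a 0 c d (app s1 (List.Sublist.cons_cons _ ?_) rfl) (by omega) h2 h3
        have hd' : [c, d].Sublist (u :: 0 :: y) := by
          cases s2 with
          | cons _ h => exact (List.sublist_cons_self b [c,d]).trans h
          | cons_cons _ h => exact h
        exact drop_u (drop_u hd' (by simp; omega)) (by simp; omega)
      · push Not at hb
        exact h a b c d (app s1 (drop_u (drop_u s2 (by simp; omega)) (by simp; omega)) rfl) h1 h2 h3
    · have ha := hx a (s1.subset (by simp)) (by omega)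
      exact h a b c d (app s1 (drop_u (drop_u s2 (by simp; omega)) (by simp; omega)) rfl) h1 h2 h3
    · have ha := hx a (s1.subset (by simp)) (by omega)
      simp at s2
      rcases s2 with s2 | s2 | s2 | s2
      · omega
      · subst s2
        have : b = 0 := by
          by_contra hb
          have := hx b (s1.subset (by simp)) hb
          omega
        subst this
        exact hg a c s1 (by omega) h3
      · omega
      · exact h a b c d (app s1 (by simp [s2]) rfl) h1 h2 h3
    · exact h a b c d (app hs (List.nil_sublist _) (by simp)) h1 h2 h3

theorem child2 (T B : Finset ℕ) (u : ℕ) (x y : List ℕ) (hu : u ≠ 0)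
    (hmin : ∀ a ∈ x ++ y, a ≠ 0 → u < a) :
    Av2 (child T B u x y) ↔ Av2 (x ++ 0 :: y) ∧ good2 x y := by
  have hx : ∀ a ∈ x, a ≠ 0 → u < a := fun a ha => hmin a (by simp [ha])
  have hy : ∀ a ∈ y, a ≠ 0 → u < a := fun a ha => hmin a (by simp [ha])
  constructor
  · intro h
    have h' : Av2 (x ++ u :: y) := fun a b c d hs => h a b c d (hs.trans (sub_child T B u x y))
    constructor
    · intro a b c d hs h1 h2 h3
      rcases sub_cases4 hs with hs | ⟨s1, s2⟩ | ⟨s1, s2⟩ | ⟨s1, s2⟩ | hs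
      · exact h' a b c d (app (List.nil_sublist _) (List.Sublist.cons _ (drop_u hs (by simp; omega))) rfl) h1 h2 h3
      · exact h' a b c d (app s1 (List.Sublist.cons _ (drop_u s2 (by simp; omega))) rfl) h1 h2 h3
      · exact h' a b c d (app s1 (List.Sublist.cons _ (drop_u s2 (by simp; omega))) rfl) h1 h2 h3
      · by_cases hd : d = 0
        · subst hd
          refine h' a b c u (app s1 (by simp) rfl) ?_ h2 h3
          exact hx b (s1.subset (by simp)) (by omega)
        · exact h' a b c d (app s1 (List.Sublist.cons _ (drop_u s2 (by simp; omega))) rfl) h1 h2 h3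
      · exact h' a b c d (app hs (List.nil_sublist _) (by simp)) h1 h2 h3
    · intro a c ha hs h1 h2
      refine h' a u c 0 (app (List.singleton_sublist.2 ha) (List.Sublist.cons_cons _ hs) rfl) (by omega) ?_ h2
      exact (hx a ha (by omega)).le
  · rintro ⟨h, hg⟩ a b c d hs h1 h2 h3
    have hs := hs.trans (child_sub T B u x y)
    rcases sub_cases4 hs with hs | ⟨s1, s2⟩ | ⟨s1, s2⟩ | ⟨s1, s2⟩ | hs
    · have s1 := drop_u hs (by simp; omega)
      have au : a ≠ u := by
        rintro rfl
        have : [b,c,d].Sublist (0 :: y) := by simpa using s1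
        have hd : b ∈ 0 :: y := this.subset (by simp)
        simp at hd
        have := hy b (hd.resolve_left (by omega)) (by omega)
        omega
      have s2 := drop_u s1 (by simp; omega)
      exact h a b c d (app (List.nil_sublist _) s2 rfl) h1 h2 h3
    · have ha := hx a (by simpa using s1) (by omega)
      have s3 := drop_u s2 (by simp; omega)
      by_cases hb : b = u
      · subst hb
        have s4 : [c, d].Sublist (0 :: y) := by simpa using s3
        have s5 := drop_u s4 (by simp; omega)
        have : d = 0 := by
          by_contra hd
          have := hy d (s5.subset (by simp)) hd
          omega
        subst this
        exact hg a c (by simpa using s1) s5 (by omega) h3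
      · exact h a b c d (app s1 (drop_u s3 (by simp; omega)) rfl) h1 h2 h3
    · have ha := hx a (s1.subset (by simp)) (by omega)
      exact h a b c d (app s1 (drop_u (drop_u s2 (by simp; omega)) (by simp; omega)) rfl) h1 h2 h3
    · have ha := hx b (s1.subset (by simp)) (by omega)
      simp at s2
      rcases s2 with s2 | s2 | s2 | s2
      · exact h a b c d (app s1 (by simp [s2]) rfl) h1 h2 h3
      · exact h a b c 0 (app s1 (by simp) rfl) (by omega) h2 h3
      · exact h a b c d (app s1 (by simp [s2]) rfl) h1 h2 h3
      · exact h a b c d (app s1 (by simp [s2]) rfl) h1 h2 h3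
    · exact h a b c d (app hs (List.nil_sublist _) (by simp)) h1 h2 h3

end W

namespace W

theorem not_ok {x z : List ℕ} (h : ¬ ∀ c ∈ z, ok x c = true) :
    ∃ a ∈ x, ∃ c ∈ z, a ≠ 0 ∧ a < c := by
  push Not at h
  obtain ⟨c, hc, h⟩ := h
  rw [Ne, ok_iff] at h
  push Not at h
  obtain ⟨a, ha, ha0, h⟩ := h
  exact ⟨a, ha, c, hc, ha0, h⟩

theorem sing {a : ℕ} {x : List ℕ} (h : a ∈ x) : [a].Sublist x := List.singleton_sublist.2 h

theorem good1_ok {x z y : List ℕ} (h : good1 (x ++ 0 :: z) y) : ∀ c ∈ z, ok x c = true := by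
  by_contra hc
  obtain ⟨a, ha, c, hc, ha0, hac⟩ := not_ok hc
  exact h a c (app (sing ha) (List.Sublist.cons_cons 0 (sing hc)) rfl) (by omega) hac

theorem ex1 (w : List ℕ) (hw : Av1 w) (hna : NA w) (h : ℕ) (hh : h ∈ st w) :
    ∃ x y, w = x ++ 0 :: y ∧ good1 x y ∧ ht x y = h := by
  have hP : ∃ n, ∃ x y, w = x ++ 0 :: y ∧ ht x y = h ∧ x.length = n := by
    obtain ⟨x, y, h1, h2⟩ := hh
    exact ⟨_, x, y, h1, h2, rfl⟩
  classical
  obtain ⟨x, y, h1, h2, h3⟩ := Nat.find_spec hP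
  have hmin := fun m hm => Nat.find_min hP (m := m) hm
  refine ⟨x, y, h1, ?_, h2⟩
  intro a c hs ha hac
  by_cases h0 : h = 0
  · have hs' : ([a, 0] ++ [c]).Sublist x := hs
    rw [List.append_sublist_iff] at hs'
    obtain ⟨r1, r2, hr, hs1, hs2⟩ := hs'
    obtain ⟨s1, s2, hs3⟩ := List.append_of_mem (List.singleton_sublist.1 hs2)
    have hs4 : [a, 0].Sublist (r1 ++ s1) := hs1.trans (List.sublist_append_left _ _)
    obtain ⟨x1, z, hz, hz0⟩ := last_zero (w := r1 ++ s1) (hs4.subset (by simp))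
    have hax : a ∈ x1 := by
      rw [hz, List.sublist_append_iff] at hs4
      obtain ⟨l1, l2, hl, hl1, hl2⟩ := hs4
      rcases l1 with _ | ⟨a', l1⟩
      · simp at hl
        subst hl
        have := drop_u hl2 (by simp; omega)
        exact absurd (this.subset (by simp)) hz0
      · simp at hl
        obtain ⟨rfl, _⟩ := hl
        exact hl1.subset (by simp)
    have hx : x = x1 ++ 0 :: (z ++ c :: s2) := by
      rw [hr, hs3, ← List.append_assoc, hz]; simp
    refine hmin x1.length ?_ ⟨x1, z ++ c :: s2 ++ 0 :: y, by rw [h1, hx]; simp, ?_, rfl⟩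
    · rw [← h3, hx]; simp
    · rw [h0]
      have e : z ++ c :: s2 ++ 0 :: y = (z ++ [c]) ++ (s2 ++ 0 :: y) := by simp
      rw [e, ht_not]
      · have := ht_le x1 (z ++ [c])
        rw [List.count_eq_zero.2] at this
        · omega
        · simp [hz0]; omega
      · intro hall
        have := (ok_iff _ _).1 (hall c (by simp)) a hax (by omega)
        omega
  · rw [← h2] at h0
    rw [h1] at hna hw
    obtain ⟨e, t, rfl, he, hok, _⟩ := ht_pos hna h0
    have := (ok_iff _ _).1 hok a (hs.subset (by simp)) (by omega)
    exact hw a 0 c e (app hs (List.Sublist.cons _ (sing (by simp))) rfl) (by omega) this hac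

theorem spec1 : Spec Av1 good1 where
  child_iff := child1
  base := by intro a b c d h; simpa using h.length_le
  ex := ex1
  uniq x z y _ h := (ht_lt (good1_ok h)).ne'
  S1 := by
    rintro x y - - h x1 z rfl
    exact Or.inl (good1_ok h)
  S2 := by
    rintro x _ hw hna - z y2 rfl
    by_cases hz : ∀ c ∈ z, ok x c = true
    · exact Or.inl (ht_lt hz)
    · right
      by_contra hne
      obtain ⟨a, ha, c, hc, ha0, hac⟩ := not_ok hz
      have e1 : x ++ 0 :: (z ++ 0 :: y2) = (x ++ 0 :: z) ++ 0 :: y2 := by simp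
      rw [e1] at hw hna
      obtain ⟨e, t, rfl, he, hok, _⟩ := ht_pos hna hne
      have := (ok_iff _ _).1 hok a (by simp [ha]) ha0
      exact hw a 0 c e (app (app (sing ha) (List.Sublist.cons_cons 0 (sing hc)) rfl)
        (List.Sublist.cons _ (sing (by simp))) rfl) (by omega) this hac
  good_nil := by
    intro y a c h; simp at h

theorem pat2 {x y : List ℕ} (hw : Av2 (x ++ 0 :: y)) (hna : NA (x ++ 0 :: y)) (h : ht x y ≠ 0) :
    good2 x y := by
  intro a c ha hs h0 hac
  obtain ⟨e, t, rfl, he, hok, _⟩ := ht_pos hna h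
  have hea := (ok_iff _ _).1 hok a ha (by omega)
  have := drop_u hs (by simp; omega)
  exact hw a e c 0 (app (sing ha) (List.Sublist.cons _ (List.Sublist.cons_cons _ this)) rfl)
    (by omega) hea hac

theorem good2_ht {x y : List ℕ} (h : good2 x y) : ht x y = y.count 0 := by
  by_cases h0 : 0 ∈ y
  · obtain ⟨z, y', rfl, hy⟩ := last_zero h0
    have hz : ∀ c ∈ z, ok x c = true := by
      by_contra hc
      obtain ⟨a, ha, c, hc, ha0, hac⟩ := not_ok hc
      exact h a c ha (app (sing hc) (sing (by simp)) rfl) (by omega) hac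
    rw [ht_all _ hz, ht_zero_cons]
    have := ht_le x y'
    have e := List.count_eq_zero.2 hy
    simp [e] at *
    omega
  · have := ht_le x y
    rw [List.count_eq_zero.2 h0] at *
    omega

theorem spec2 : Spec Av2 good2 where
  child_iff := child2
  base := by intro a b c d h; simpa using h.length_le
  ex := by
    rintro w hw hna h ⟨x, y, rfl, rfl⟩
    by_cases h0 : ht x y = 0
    · obtain ⟨x', y', e, hy⟩ := last_zero (w := x ++ 0 :: y) (by simp)
      have hg : good2 x' y' := by
        intro a c _ hs
        exact absurd (hs.subset (by simp)) hy
      refine ⟨x', y', e, hg, ?_⟩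
      rw [good2_ht hg, h0, List.count_eq_zero.2 hy]
    · exact ⟨x, y, rfl, pat2 hw hna h0, rfl⟩
  uniq x z y h1 h2 := by
    rw [good2_ht h1, good2_ht h2]; simp; omega
  S1 := by
    rintro _ y hw hna hg x1 z rfl
    by_cases hz : ∀ c ∈ z, ok x1 c = true
    · exact Or.inl hz
    · right
      by_contra hne
      obtain ⟨a, ha, c, hc, ha0, hac⟩ := not_ok hz
      have e1 : x1 ++ 0 :: z ++ 0 :: y = x1 ++ 0 :: (z ++ 0 :: y) := by simp
      rw [e1] at hw hna
      exact pat2 hw hna hne a c ha (app (sing hc) (sing (by simp)) rfl) (by omega) hac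
  S2 := by
    rintro x _ hw hna hg z y2 rfl
    left
    have := ht_le (x ++ 0 :: z) y2
    rw [good2_ht hg]; simp; omega
  good_nil := by
    intro y a c h; simp at h

end W

namespace W

def TypAt (T B L : Finset ℕ) (p : List ℕ) (u : ℕ) (s : List ℕ) : Prop :=
  (u ∈ T ↔ ∃ z ∈ s.head?, z < u) ∧ (u ∈ B ↔ ∃ z ∈ p.getLast?, u < z) ∧ (u ∈ L ↔ ∀ l ∈ p, l < u)

structure Conf (n v : ℕ) (T B L : Finset ℕ) (w : List ℕ) : Prop where
  head : ∃ t, w = 0 :: t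
  na : NA w
  cnt : ∀ u, u ≠ 0 → w.count u = if v < u ∧ u ≤ n then 1 else 0
  typ : ∀ p u s, w = p ++ u :: s → u ≠ 0 → TypAt T B L p u s

theorem Conf.mem {n v : ℕ} {T B L : Finset ℕ} {w : List ℕ} (h : Conf n v T B L w) {a : ℕ}
    (ha : a ∈ w) (h0 : a ≠ 0) : v < a ∧ a ≤ n := by
  by_contra hc
  have := h.cnt a h0
  rw [if_neg hc] at this
  exact List.count_eq_zero.1 this ha

theorem na_iff (x y : List ℕ) : NA (x ++ 0 :: y) ↔
    NA x ∧ NA y ∧ 0 ∉ x.getLast? ∧ 0 ∉ y.head? := by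
  constructor
  · intro h
    refine ⟨?_, ?_, ?_, ?_⟩
    · rintro p s rfl; exact h p (s ++ 0 :: y) (by simp)
    · rintro p s rfl; exact h (x ++ 0 :: p) s (by simp)
    · intro h0
      rcases List.eq_nil_or_concat x with rfl | ⟨z, b, rfl⟩
      · simp at h0
      · simp at h0; subst h0; exact h z y (by simp)
    · intro h0
      cases y with
      | nil => simp at h0
      | cons c y => simp at h0; subst h0; exact h x y rfl
  · rintro ⟨h1, h2, h3, h4⟩ p s h
    rcases split2 h with ⟨rfl, -, rfl⟩ | ⟨z, rfl, rfl⟩ | ⟨z, rfl, h⟩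
    · simp at h4
    · exact h2 z s rfl
    · cases z with
      | nil => simp at h3
      | cons c z => simp at h; obtain ⟨rfl, _⟩ := h; exact h1 p z (by simp)

theorem na_iff' (x y : List ℕ) {u : ℕ} (hu : u ≠ 0) : NA (x ++ u :: y) ↔ NA x ∧ NA y := by
  constructor
  · intro h
    refine ⟨?_, ?_⟩
    · rintro p s rfl; exact h p (s ++ u :: y) (by simp)
    · rintro p s rfl; exact h (x ++ u :: p) s (by simp)
  · rintro ⟨h1, h2⟩ p s h
    rcases split2 h with ⟨-, h, -⟩ | ⟨z, rfl, rfl⟩ | ⟨z, rfl, h⟩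
    · exact hu h
    · exact h2 z s rfl
    · cases z with
      | nil => simp at h; exact hu h.1
      | cons c z => simp at h; obtain ⟨rfl, _⟩ := h; exact h1 p z (by simp)

theorem na_nil : NA [] := by intro p s h; simp at h

theorem na_child (T B : Finset ℕ) {u : ℕ} (hu : u ≠ 0) (x y : List ℕ) :
    NA (child T B u x y) ↔ NA x ∧ NA y ∧ (u ∉ B → 0 ∉ x.getLast?) ∧ (u ∈ T → 0 ∉ y.head?) := by
  unfold child
  rw [na_iff' _ _ hu]
  have e := na_iff x []
  have e' := na_iff [] y
  simp only [List.nil_append] at e'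
  by_cases h1 : u ∈ B <;> by_cases h2 : u ∈ T <;> simp [lf, rg, h1, h2, e, e', na_nil] <;> tauto

theorem typ_right (T B L : Finset ℕ) {u a : ℕ} (hua : u < a) (p z y : List ℕ) :
    TypAt T B L p a (z ++ lf u B ++ u :: (rg u T ++ y)) ↔ TypAt T B L p a (z ++ 0 :: y) := by
  unfold TypAt
  cases z with
  | nil =>
    have h0 : 0 < a := by omega
    by_cases h1 : u ∈ B <;> simp [lf, h1, hua, h0]
  | cons c z => simp

theorem typ_left (T B L : Finset ℕ) {u a : ℕ} (hua : u < a) (x z s : List ℕ) :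
    TypAt T B L (x ++ lf u B ++ u :: (rg u T ++ z)) a s ↔ TypAt T B L (x ++ 0 :: z) a s := by
  unfold TypAt
  have h0 : 0 < a := by omega
  have e1 : (∃ w ∈ (x ++ lf u B ++ u :: (rg u T ++ z)).getLast?, a < w) ↔
      ∃ w ∈ (x ++ 0 :: z).getLast?, a < w := by
    rcases List.eq_nil_or_concat z with rfl | ⟨z, b, rfl⟩
    · by_cases h2 : u ∈ T <;> simp [rg, h2, List.getLast?_append, List.getLast?_cons]
      omega
    · simp [List.getLast?_append, List.getLast?_cons]
  have e2 : (∀ l ∈ x ++ lf u B ++ u :: (rg u T ++ z), l < a) ↔ ∀ l ∈ x ++ 0 :: z, l < a := by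
    by_cases h1 : u ∈ B <;> by_cases h2 : u ∈ T <;> simp [lf, rg, h1, h2, or_imp, forall_and, hua, h0]
  rw [e1, e2]

theorem count_child (T B : Finset ℕ) (u : ℕ) (x y : List ℕ) {a : ℕ} (ha : a ≠ 0) :
    (child T B u x y).count a = (x ++ 0 :: y).count a + if a = u then 1 else 0 := by
  have ha' : ¬ (0 = a) := fun h => ha h.symm
  by_cases h1 : u ∈ B <;> by_cases h2 : u ∈ T <;>
    simp [child, lf, rg, h1, h2, List.count_append, List.count_cons, ha', eq_comm (a := u)] <;> omega

theorem conf_child {n v : ℕ} {T B L : Finset ℕ} (hv : v < n) {x y : List ℕ}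
    (h : Conf n (v + 1) T B L (x ++ 0 :: y)) (hx : x = [] ↔ v + 1 ∈ L)
    (hBL : ¬ (v + 1 ∈ B ∧ v + 1 ∈ L)) : Conf n v T B L (child T B (v + 1) x y) := by
  set u := v + 1 with hu
  have hu0 : u ≠ 0 := by omega
  have hxm : ∀ a ∈ x, a ≠ 0 → u < a := fun a ha h0 => (h.mem (by simp [ha]) h0).1
  have hym : ∀ a ∈ y, a ≠ 0 → u < a := fun a ha h0 => (h.mem (by simp [ha]) h0).1
  have hna := (na_iff x y).1 h.na
  refine ⟨?_, ?_, ?_, ?_⟩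
  · obtain ⟨t, ht⟩ := h.head
    cases x with
    | nil =>
      have : u ∉ B := fun hb => hBL ⟨hb, hx.1 rfl⟩
      simp [child, lf, this]
    | cons c x =>
      simp at ht
      simp [child, ht.1]
  · rw [na_child T B hu0]; tauto
  · intro a ha
    rw [count_child _ _ _ _ _ ha, h.cnt a ha]
    split_ifs <;> omega
  · intro p a s hs ha
    rw [child] at hs
    rcases split2 hs with ⟨rfl, rfl, rfl⟩ | ⟨z, rfl, h2⟩ | ⟨z, h1, rfl⟩
    · refine ⟨?_, ?_, ?_⟩
      · by_cases hT : u ∈ T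
        · simp [rg, hT, Nat.pos_of_ne_zero hu0]
        · simp only [rg, hT, if_false, List.nil_append, false_iff]
          rintro ⟨z, hz, hzu⟩
          have hz0 : z ≠ 0 := by rintro rfl; exact hna.2.2.2 hz
          have := hym z (List.mem_of_mem_head? hz) hz0
          omega
      · by_cases hB : u ∈ B
        · simp only [lf, hB, if_true, List.append_nil, true_iff]
          have hxne : x ≠ [] := fun e => hBL ⟨hB, hx.1 e⟩
          refine ⟨x.getLast hxne, by simp [List.getLast?_eq_getLast_of_ne_nil hxne], ?_⟩
          apply hxm _ (List.getLast_mem hxne)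
          intro e
          apply hna.2.2.1
          simp [List.getLast?_eq_getLast_of_ne_nil hxne, e]
        · simp [lf, hB]
      · rw [← hx]
        constructor
        · rintro rfl
          by_cases hB : u ∈ B <;> simp [lf, hB, Nat.pos_of_ne_zero hu0]
        · intro hl
          by_contra hxne
          have h3 : x.getLast hxne ≠ 0 := by
            intro e
            apply hna.2.2.1
            simp [List.getLast?_eq_getLast_of_ne_nil hxne, e]
          have := hxm _ (List.getLast_mem hxne) h3
          have := hl (x.getLast hxne) (by simp)
          omega
    · -- a in right part
      have ⟨z', hz1, hz2⟩ : ∃ z', z = rg u T ++ z' ∧ y = z' ++ a :: s := by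
        by_cases hT : u ∈ T
        · simp only [rg, hT, if_true, List.cons_append, List.nil_append] at h2 ⊢
          cases z with
          | nil => simp at h2; exact absurd h2.1.symm ha
          | cons c z => simp at h2; exact ⟨z, by simp [h2.1], h2.2⟩
        · simp only [rg, hT, if_false, List.nil_append] at h2 ⊢
          exact ⟨z, rfl, h2⟩
      subst hz1 hz2
      rw [typ_left T B L (hym a (by simp) ha)]
      exact h.typ _ _ _ (by simp) ha
    · have ⟨z', hz1, hz2⟩ : ∃ z', z = z' ++ lf u B ∧ x = p ++ a :: z' := by
        by_cases hB : u ∈ B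
        · simp [lf, hB] at h1 ⊢
          exact h1
        · simp only [lf, hB, if_false] at h1 ⊢
          rcases List.eq_nil_or_concat z with rfl | ⟨z, b, rfl⟩
          · have h3 := (List.append_inj' (s₁ := x) (s₂ := p) (t₁ := [0]) (t₂ := [a]) h1 rfl).2
            simp at h3; exact absurd h3.symm ha
          · have h3 : x ++ [0] = (p ++ a :: z) ++ [b] := by simpa using h1
            obtain ⟨h4, h5⟩ := List.append_inj' h3 rfl
            simp at h5
            exact ⟨z, by simp [h5], h4⟩
      subst hz1 hz2
      rw [typ_right T B L (hxm a (by simp) ha)]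
      exact h.typ _ _ _ (by simp) ha

theorem conf_parent {n v : ℕ} {T B L : Finset ℕ} (hv : v < n) {w : List ℕ}
    (h : Conf n v T B L w) : ∃ x y, w = child T B (v + 1) x y ∧
      Conf n (v + 1) T B L (x ++ 0 :: y) ∧ (x = [] ↔ v + 1 ∈ L) ∧
      ¬ (v + 1 ∈ B ∧ v + 1 ∈ L) := by
  set u := v + 1 with hu
  have hu0 : u ≠ 0 := by omega
  have hc := h.cnt u hu0
  rw [if_pos (by omega)] at hc
  obtain ⟨p, s, rfl⟩ := List.append_of_mem (List.count_pos_iff.1 (hc ▸ Nat.one_pos))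
  have hps : u ∉ p ∧ u ∉ s := by
    simp [List.count_append] at hc
    exact ⟨List.count_eq_zero.1 (by omega), List.count_eq_zero.1 (by omega)⟩
  have hpm : ∀ a ∈ p, a ≠ 0 → u < a := by
    intro a ha h0
    have := (h.mem (a := a) (by simp [ha]) h0).1
    have : a ≠ u := by rintro rfl; exact hps.1 ha
    omega
  have hsm : ∀ a ∈ s, a ≠ 0 → u < a := by
    intro a ha h0
    have := (h.mem (a := a) (by simp [ha]) h0).1
    have : a ≠ u := by rintro rfl; exact hps.2 ha
    omega
  obtain ⟨t, ht⟩ := h.head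
  have hpne : p ≠ [] := by rintro rfl; simp at ht
  obtain ⟨tT, tB, tL⟩ := h.typ p u s rfl hu0
  have ⟨x, hx⟩ : ∃ x, p = x ++ lf u B := by
    by_cases hB : u ∈ B
    · exact ⟨p, by simp [lf, hB]⟩
    · rcases List.eq_nil_or_concat p with rfl | ⟨z, b, rfl⟩
      · exact absurd rfl hpne
      · refine ⟨z, ?_⟩
        have : b = 0 := by
          by_contra hb
          exact hB (tB.2 ⟨b, by simp, hpm b (by simp) hb⟩)
        simp [lf, hB, this]
  have ⟨y, hy⟩ : ∃ y, s = rg u T ++ y := by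
    by_cases hT : u ∈ T
    · obtain ⟨z, hz, hzu⟩ := tT.1 hT
      have : z = 0 := by
        by_contra hb
        have := hsm z (List.mem_of_mem_head? hz) hb
        omega
      subst this
      cases s with
      | nil => simp at hz
      | cons c s => simp at hz; exact ⟨s, by simp [rg, hT, hz]⟩
    · exact ⟨s, by simp [rg, hT]⟩
  have hw : p ++ u :: s = child T B u x y := by rw [hx, hy, child]
  have hna := h.na
  rw [hw, na_child T B hu0] at hna
  have hnapar : NA (x ++ 0 :: y) := by
    rw [na_iff]
    refine ⟨hna.1, hna.2.1, ?_, ?_⟩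
    · by_cases hB : u ∈ B
      · obtain ⟨z, hz, hzu⟩ := tB.1 hB
        simp [hx, lf, hB] at hz
        simp [hz]; omega
      · exact hna.2.2.1 hB
    · by_cases hT : u ∈ T
      · exact hna.2.2.2 hT
      · intro h0
        apply hT
        refine tT.2 ⟨0, ?_, by omega⟩
        simpa [hy, rg, hT] using h0
  have hxm : ∀ a ∈ x, a ≠ 0 → u < a := fun a ha => hpm a (by simp [hx, ha])
  have hym : ∀ a ∈ y, a ≠ 0 → u < a := fun a ha => hsm a (by simp [hy, ha])
  have hxL : x = [] ↔ u ∈ L := by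
    rw [tL]
    constructor
    · intro e
      rw [hx, e]
      by_cases hB : u ∈ B <;> simp [lf, hB, Nat.pos_of_ne_zero hu0]
    · intro hl
      by_contra hxne
      have h3 : x.getLast hxne ≠ 0 := by
        intro e
        apply ((na_iff x y).1 hnapar).2.2.1
        simp [List.getLast?_eq_getLast_of_ne_nil hxne, e]
      have := hxm _ (List.getLast_mem hxne) h3
      have := hl (x.getLast hxne) (by simp [hx])
      omega
  refine ⟨x, y, hw, ⟨?_, hnapar, ?_, ?_⟩, hxL, ?_⟩
  · cases x with
    | nil => simp
    | cons c x =>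
      rw [hx] at ht
      simp at ht
      simp [ht.1]
  · intro a ha
    have := h.cnt a ha
    rw [hw, count_child _ _ _ _ _ ha] at this
    split_ifs at this ⊢ <;> omega
  · intro p' a s' hs ha
    rcases split2 hs with ⟨_, h', _⟩ | ⟨z, h1, h2⟩ | ⟨z, h1, h2⟩
    · exact absurd h'.symm ha
    · rw [h1, ← typ_left T B L (hym a (by simp [h2]) ha)]
      exact h.typ _ _ _ (by simp [hx, hy, h2]) ha
    · rw [h2, ← typ_right T B L (hxm a (by simp [h1]) ha)]
      exact h.typ _ _ _ (by simp [hx, hy, h1]) ha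
  · rintro ⟨hB, hL⟩
    have := hxL.2 hL
    apply hpne
    simp [hx, this, lf, hB]

end W

namespace W

def S (Av : List ℕ → Prop) (n v : ℕ) (T B L : Finset ℕ) : Type :=
  {w : List ℕ // Av w ∧ Conf n v T B L w}

def allowed (B L : Finset ℕ) (u : ℕ) (H : Set ℕ) (h : ℕ) : Prop :=
  h ∈ H ∧ ¬ (u ∈ B ∧ u ∈ L) ∧ ((∀ h' ∈ H, h' ≤ h) ↔ u ∈ L)

theorem max_iff {x y : List ℕ} (hh : ∃ t, x ++ 0 :: y = 0 :: t) :
    (∀ h' ∈ st (x ++ 0 :: y), h' ≤ ht x y) ↔ x = [] := by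
  constructor
  · intro h
    cases x with
    | nil => rfl
    | cons c x =>
      obtain ⟨t, ht'⟩ := hh
      simp at ht'
      have h1 := h (ht [] (x ++ 0 :: y)) ⟨[], x ++ 0 :: y, by simp [ht'.1], rfl⟩
      rw [ht_nil] at h1
      have := ht_le (c :: x) y
      simp at h1
      omega
  · rintro rfl h' ⟨X, Y, hXY, rfl⟩
    rw [ht_nil]
    refine (ht_le X Y).trans ?_
    have : (X ++ 0 :: Y).count 0 = y.count 0 + 1 := by rw [← hXY]; simp
    simp at this
    omega

theorem child_inj {T B : Finset ℕ} {u : ℕ} {x y x' y' : List ℕ} (hu : u ≠ 0)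
    (hx : u ∉ x) (hx' : u ∉ x') (h : child T B u x y = child T B u x' y') : x = x' ∧ y = y' := by
  have hl : u ∉ lf u B := by by_cases hB : u ∈ B <;> simp [lf, hB, hu]
  unfold child at h
  rcases split2 h with ⟨h1, _, h2⟩ | ⟨z, h1, _⟩ | ⟨z, h1, _⟩
  · exact ⟨List.append_cancel_right h1, List.append_cancel_left h2⟩
  · have : u ∈ x' ++ lf u B := by rw [h1]; simp
    simp [hx', hl] at this
  · have : u ∈ x ++ lf u B := by rw [h1]; simp
    simp [hx, hl] at this

theorem Spec.uniq' {Av : List ℕ → Prop} {good : List ℕ → List ℕ → Prop} (sp : Spec Av good)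
    {x y x' y' : List ℕ} (e : x ++ 0 :: y = x' ++ 0 :: y') (g : good x y) (g' : good x' y')
    (h : ht x y = ht x' y') : x = x' ∧ y = y' := by
  rcases split2 e with ⟨h1, _, h2⟩ | ⟨z, rfl, rfl⟩ | ⟨z, rfl, rfl⟩
  · exact ⟨h1, h2⟩
  · exact absurd h (sp.uniq _ _ _ g g')
  · exact absurd h.symm (sp.uniq _ _ _ g' g)

theorem step {Av : List ℕ → Prop} {good : List ℕ → List ℕ → Prop} (sp : Spec Av good)
    {n v : ℕ} (hv : v < n) (T B L : Finset ℕ) :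
    ∃ e : (Σ w : S Av n (v + 1) T B L, {h // allowed B L (v + 1) (st w.1) h}) ≃ S Av n v T B L,
      ∀ p, st (e p).1 = tr T B (v + 1) (st p.1.1) p.2.1 := by
  have hu0 : v + 1 ≠ 0 := by omega
  have H : ∀ p : (Σ w : S Av n (v + 1) T B L, {h // allowed B L (v + 1) (st w.1) h}),
      ∃ xy : List ℕ × List ℕ, p.1.1 = xy.1 ++ 0 :: xy.2 ∧ good xy.1 xy.2 ∧ ht xy.1 xy.2 = p.2.1 := by
    intro p
    obtain ⟨x, y, h⟩ := sp.ex p.1.1 p.1.2.1 p.1.2.2.na p.2.1 p.2.2.1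
    exact ⟨(x, y), h⟩
  choose g hg1 hg2 hg3 using H
  have hmin : ∀ p, ∀ a ∈ (g p).1 ++ (g p).2, a ≠ 0 → v + 1 < a := by
    intro p a ha h0
    refine (p.1.2.2.mem (a := a) ?_ h0).1
    rw [hg1 p]
    simp at ha ⊢; tauto
  have hC : ∀ p, Conf n v T B L (child T B (v + 1) (g p).1 (g p).2) := by
    intro p
    have hc := p.1.2.2
    have ha := p.2.2
    rw [hg1 p] at hc
    refine conf_child hv hc ?_ ha.2.1
    rw [← ha.2.2, ← hg3 p, hg1 p, max_iff hc.head]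
  have hA : ∀ p, Av (child T B (v + 1) (g p).1 (g p).2) := by
    intro p
    rw [sp.child_iff T B (v + 1) _ _ hu0 (hmin p), ← hg1 p]
    exact ⟨p.1.2.1, hg2 p⟩
  let f : (Σ w : S Av n (v + 1) T B L, {h // allowed B L (v + 1) (st w.1) h}) → S Av n v T B L :=
    fun p => ⟨child T B (v + 1) (g p).1 (g p).2, hA p, hC p⟩
  have hf : Function.Bijective f := by
    constructor
    · intro p q hpq
      have h1 : child T B (v + 1) (g p).1 (g p).2 = child T B (v + 1) (g q).1 (g q).2 :=
        congrArg Subtype.val hpq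
      have h2 := child_inj hu0 (fun h => absurd (hmin p _ (by simp [h]) hu0) (lt_irrefl _))
        (fun h => absurd (hmin q _ (by simp [h]) hu0) (lt_irrefl _)) h1
      have h3 : p.1 = q.1 := Subtype.ext (by rw [hg1 p, hg1 q, h2.1, h2.2])
      have h4 : p.2.1 = q.2.1 := by rw [← hg3 p, ← hg3 q, h2.1, h2.2]
      obtain ⟨w, h, hh⟩ := p
      obtain ⟨w', h', hh'⟩ := q
      simp only at h3 h4
      subst h3 h4
      rfl
    · rintro ⟨w, hw, hc⟩
      obtain ⟨x, y, rfl, hc', hxL, hBL⟩ := conf_parent hv hc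
      have hm : ∀ a ∈ x ++ y, a ≠ 0 → v + 1 < a := by
        intro a ha h0
        exact (hc'.mem (a := a) (by simp at ha ⊢; tauto) h0).1
      rw [sp.child_iff T B (v + 1) x y hu0 hm] at hw
      let p : (Σ w : S Av n (v + 1) T B L, {h // allowed B L (v + 1) (st w.1) h}) :=
        ⟨⟨x ++ 0 :: y, hw.1, hc'⟩, ⟨ht x y, ⟨x, y, rfl, rfl⟩, hBL, by rw [max_iff hc'.head, hxL]⟩⟩
      have h5 := sp.uniq' (hg1 p) hw.2 (hg2 p) (hg3 p).symm
      exact ⟨p, Subtype.ext (by change child _ _ _ _ _ = child _ _ _ _ _; rw [← h5.1, ← h5.2])⟩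
  refine ⟨Equiv.ofBijective f hf, ?_⟩
  intro p
  change st (child T B (v + 1) (g p).1 (g p).2) = _
  have hna := p.1.2.2.na
  have hav := p.1.2.1
  rw [hg1 p] at hna hav
  rw [st_child T B hu0 (hmin p) (hC p).na ?_ (sp.S1 _ _ hav hna (hg2 p))
    (sp.S2 _ _ hav hna (hg2 p)), ← hg1 p, hg3 p]
  obtain ⟨t, ht'⟩ := (hC p).head
  rw [ht']; simp

theorem conf_base {n : ℕ} {T B L : Finset ℕ} (w : List ℕ) : Conf n n T B L w ↔ w = [0] := by
  constructor
  · intro h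
    have h0 : ∀ a ∈ w, a = 0 := by
      intro a ha
      by_contra h0
      have := h.mem ha h0
      omega
    obtain ⟨t, rfl⟩ := h.head
    cases t with
    | nil => rfl
    | cons c t =>
      have : c = 0 := h0 c (by simp)
      subst this
      exact absurd rfl (h.na [] t)
  · rintro rfl
    refine ⟨⟨[], rfl⟩, ?_, ?_, ?_⟩
    · intro p s h
      have := congrArg List.length h
      simp at this
      omega
    · intro u hu
      rw [if_neg (by omega), List.count_eq_zero]
      simpa using hu
    · intro p u s h hu
      have : u ∈ [0] := by rw [h]; simp
      simp at this
      exact absurd this hu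

theorem levels {Av Av' : List ℕ → Prop} {good good' : List ℕ → List ℕ → Prop}
    (sp : Spec Av good) (sp' : Spec Av' good') {n : ℕ} (T B L : Finset ℕ) (k : ℕ) :
    ∀ v, v + k = n →
    ∃ e : S Av n v T B L ≃ S Av' n v T B L, ∀ w, st (e w).1 = st w.1 := by
  induction k with
  | zero =>
    rintro v rfl
    have u1 : ∀ a : S Av v v T B L, a.1 = [0] := fun a => (conf_base a.1).1 a.2.2
    have u2 : ∀ a : S Av' v v T B L, a.1 = [0] := fun a => (conf_base a.1).1 a.2.2
    refine ⟨⟨fun _ => ⟨[0], sp'.base, (conf_base _).2 rfl⟩,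
      fun _ => ⟨[0], sp.base, (conf_base _).2 rfl⟩,
      fun a => Subtype.ext (u1 a).symm, fun a => Subtype.ext (u2 a).symm⟩, ?_⟩
    intro w
    rw [u1 w]; rfl
  | succ k ih =>
    intro v hv
    obtain ⟨e, he⟩ := ih (v + 1) (by omega)
    obtain ⟨e1, h1⟩ := step sp (n := n) (v := v) (by omega) T B L
    obtain ⟨e2, h2⟩ := step sp' (n := n) (v := v) (by omega) T B L
    let c : (Σ w : S Av n (v + 1) T B L, {h // allowed B L (v + 1) (st w.1) h}) ≃
        (Σ w : S Av' n (v + 1) T B L, {h // allowed B L (v + 1) (st w.1) h}) :=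
      Equiv.sigmaCongr e (fun w => Equiv.subtypeEquivRight (fun h => by rw [he w]))
    refine ⟨(e1.symm.trans c).trans e2, ?_⟩
    intro w
    obtain ⟨p, rfl⟩ := e1.surjective w
    simp only [Equiv.trans_apply, Equiv.symm_apply_apply]
    rw [h1, h2]
    change tr T B (v + 1) (st (e p.1).1) p.2.1 = _
    rw [he]

theorem one_zero {w : List ℕ} (hh : ∃ t, w = 0 :: t) : w.count 0 = 1 ↔ ∀ h ∈ st w, h = 0 := by
  obtain ⟨t, rfl⟩ := hh
  constructor
  · rintro h _ ⟨x, y, hxy, rfl⟩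
    have := ht_le x y
    rw [hxy] at h
    simp at h
    omega
  · intro h
    have := h (ht [] t) ⟨[], t, rfl, rfl⟩
    rw [ht_nil] at this
    simp [this]

theorem final_equiv {Av Av' : List ℕ → Prop} {good good' : List ℕ → List ℕ → Prop}
    (sp : Spec Av good) (sp' : Spec Av' good') (n : ℕ) (T B L : Finset ℕ) :
    Nonempty ({w : List ℕ // (Av w ∧ Conf n 0 T B L w) ∧ w.count 0 = 1} ≃
      {w : List ℕ // (Av' w ∧ Conf n 0 T B L w) ∧ w.count 0 = 1}) := by
  obtain ⟨e, he⟩ := levels sp sp' (n := n) T B L n 0 (by omega)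
  have e3 : {w : S Av n 0 T B L // w.1.count 0 = 1} ≃ {w : S Av' n 0 T B L // w.1.count 0 = 1} := by
    refine e.subtypeEquiv ?_
    intro w
    rw [one_zero w.2.2.head, one_zero (e w).2.2.head, he]
  exact ⟨((Equiv.subtypeSubtypeEquivSubtypeInter (fun w => Av w ∧ Conf n 0 T B L w)
      (fun w : List ℕ => w.count 0 = 1)).symm.trans e3).trans
    (Equiv.subtypeSubtypeEquivSubtypeInter (fun w => Av' w ∧ Conf n 0 T B L w)
      (fun w : List ℕ => w.count 0 = 1))⟩

end W

namespace W

def word {n : ℕ} (σ : Equiv.Perm (Fin n)) : List ℕ := 0 :: List.ofFn (fun i : Fin n => (σ i : ℕ) + 1)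

theorem entry_eq {n : ℕ} (σ : Equiv.Perm (Fin n)) (i : ℕ) (h : i < n) :
    entry σ (i + 1) = (σ ⟨i, h⟩ : ℕ) + 1 := by simp [entry, h]

theorem entry_mem {n : ℕ} (σ : Equiv.Perm (Fin n)) {i : ℕ} (h1 : 1 ≤ i) (h : i ≤ n) :
    1 ≤ entry σ i ∧ entry σ i ≤ n := by
  obtain ⟨i, rfl⟩ := Nat.exists_eq_succ_of_ne_zero (by omega : i ≠ 0)
  rw [entry_eq σ i (by omega)]
  have := (σ ⟨i, by omega⟩).2
  omega

theorem entry_inj {n : ℕ} (σ : Equiv.Perm (Fin n)) {i j : ℕ} (h1 : 1 ≤ i) (h : i ≤ n)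
    (h1' : 1 ≤ j) (h' : j ≤ n) (e : entry σ i = entry σ j) : i = j := by
  obtain ⟨i, rfl⟩ := Nat.exists_eq_succ_of_ne_zero (by omega : i ≠ 0)
  obtain ⟨j, rfl⟩ := Nat.exists_eq_succ_of_ne_zero (by omega : j ≠ 0)
  rw [entry_eq σ i (by omega), entry_eq σ j (by omega)] at e
  have := σ.injective (Fin.ext (Nat.succ_injective e))
  simp at this
  omega

theorem entry_surj {n : ℕ} (σ : Equiv.Perm (Fin n)) {u : ℕ} (h1 : 1 ≤ u) (h : u ≤ n) :
    ∃ i, 1 ≤ i ∧ i ≤ n ∧ entry σ i = u := by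
  obtain ⟨i, hi⟩ := σ.surjective ⟨u - 1, by omega⟩
  refine ⟨i + 1, by omega, i.2, ?_⟩
  rw [entry_eq σ i i.2]
  simp [hi]; omega

theorem mem_dtops {n : ℕ} (σ : Equiv.Perm (Fin n)) {i : ℕ} (h1 : 1 ≤ i) (h : i ≤ n) :
    entry σ i ∈ Destop σ ↔ i + 1 ≤ n ∧ entry σ (i + 1) < entry σ i := by
  simp only [Destop, Des, Finset.mem_image, Finset.mem_filter, Finset.mem_Icc]
  constructor
  · rintro ⟨j, ⟨⟨hj1, hj2⟩, hj⟩, e⟩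
    have := entry_inj σ hj1 (by omega) h1 h e
    subst this
    exact ⟨by omega, hj⟩
  · rintro ⟨h2, h3⟩
    exact ⟨i, ⟨⟨h1, by omega⟩, h3⟩, rfl⟩

theorem mem_desbot {n : ℕ} (σ : Equiv.Perm (Fin n)) {i : ℕ} (h1 : 1 ≤ i) (h : i ≤ n) :
    entry σ i ∈ Desbot σ ↔ 2 ≤ i ∧ entry σ i < entry σ (i - 1) := by
  simp only [Desbot, Des, Finset.mem_image, Finset.mem_filter, Finset.mem_Icc]
  constructor
  · rintro ⟨j, ⟨⟨hj1, hj2⟩, hj⟩, e⟩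
    have := entry_inj σ (by omega) (by omega) h1 h e
    subst this
    exact ⟨by omega, hj⟩
  · rintro ⟨h2, h3⟩
    exact ⟨i - 1, ⟨⟨by omega, by omega⟩, by rwa [Nat.sub_add_cancel h1]⟩, by rw [Nat.sub_add_cancel h1]⟩

theorem mem_asctop {n : ℕ} (σ : Equiv.Perm (Fin n)) {i : ℕ} (h1 : 1 ≤ i) (h : i ≤ n) :
    entry σ i ∈ Asctop σ ↔ 2 ≤ i ∧ entry σ (i - 1) < entry σ i := by
  simp only [Asctop, Asc, Finset.mem_image, Finset.mem_filter, Finset.mem_Icc]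
  constructor
  · rintro ⟨j, ⟨⟨hj1, hj2⟩, hj⟩, e⟩
    have := entry_inj σ (by omega) (by omega) h1 h e
    subst this
    exact ⟨by omega, hj⟩
  · rintro ⟨h2, h3⟩
    exact ⟨i - 1, ⟨⟨by omega, by omega⟩, by rwa [Nat.sub_add_cancel h1]⟩, by rw [Nat.sub_add_cancel h1]⟩

theorem mem_lrmax {n : ℕ} (σ : Equiv.Perm (Fin n)) {i : ℕ} (h1 : 1 ≤ i) (h : i ≤ n) :
    entry σ i ∈ LRmax σ ↔ ∀ j, 1 ≤ j → j < i → entry σ j < entry σ i := by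
  simp only [LRmax, Finset.mem_image, Finset.mem_filter, Finset.mem_Icc]
  constructor
  · rintro ⟨j, ⟨⟨hj1, hj2⟩, hj⟩, e⟩
    have := entry_inj σ hj1 hj2 h1 h e
    subst this
    exact hj
  · intro h3
    exact ⟨i, ⟨⟨h1, h⟩, h3⟩, rfl⟩

theorem dtops_sub {n : ℕ} (σ : Equiv.Perm (Fin n)) : Destop σ ⊆ Finset.Icc 1 n := by
  intro u hu
  simp only [Destop, Des, Finset.mem_image, Finset.mem_filter, Finset.mem_Icc] at hu ⊢
  obtain ⟨j, ⟨⟨hj1, hj2⟩, hj⟩, rfl⟩ := hu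
  exact entry_mem σ hj1 (by omega)

theorem desbot_sub {n : ℕ} (σ : Equiv.Perm (Fin n)) : Desbot σ ⊆ Finset.Icc 1 n := by
  intro u hu
  simp only [Desbot, Des, Finset.mem_image, Finset.mem_filter, Finset.mem_Icc] at hu ⊢
  obtain ⟨j, ⟨⟨hj1, hj2⟩, hj⟩, rfl⟩ := hu
  exact entry_mem σ (by omega) (by omega)

theorem asctop_sub {n : ℕ} (σ : Equiv.Perm (Fin n)) : Asctop σ ⊆ Finset.Icc 1 n := by
  intro u hu
  simp only [Asctop, Asc, Finset.mem_image, Finset.mem_filter, Finset.mem_Icc] at hu ⊢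
  obtain ⟨j, ⟨⟨hj1, hj2⟩, hj⟩, rfl⟩ := hu
  exact entry_mem σ (by omega) (by omega)

theorem lrmax_sub {n : ℕ} (σ : Equiv.Perm (Fin n)) : LRmax σ ⊆ Finset.Icc 1 n := by
  intro u hu
  simp only [LRmax, Finset.mem_image, Finset.mem_filter, Finset.mem_Icc] at hu ⊢
  obtain ⟨j, ⟨⟨hj1, hj2⟩, hj⟩, rfl⟩ := hu
  exact entry_mem σ (by omega) (by omega)

theorem eq_iff_entry {n : ℕ} (σ : Equiv.Perm (Fin n)) {X Y : Finset ℕ}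
    (hX : X ⊆ Finset.Icc 1 n) (hY : Y ⊆ Finset.Icc 1 n) :
    X = Y ↔ ∀ i, 1 ≤ i → i ≤ n → (entry σ i ∈ Y ↔ entry σ i ∈ X) := by
  constructor
  · rintro rfl i _ _; rfl
  · intro h
    ext u
    by_cases hu : 1 ≤ u ∧ u ≤ n
    · obtain ⟨i, h1, h2, rfl⟩ := entry_surj σ hu.1 hu.2
      exact (h i h1 h2).symm
    · have e1 : u ∉ X := fun h => hu (Finset.mem_Icc.1 (hX h))
      have e2 : u ∉ Y := fun h => hu (Finset.mem_Icc.1 (hY h))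
      simp [e1, e2]

/-- Asctop as a function of Desbot and LRmax. -/
def ascF (n : ℕ) (B L : Finset ℕ) : Finset ℕ :=
  (Finset.Icc 1 n).filter (fun u => u ∉ B ∧ ¬ (u ∈ L ∧ ∀ l ∈ L, u ≤ l))

theorem asctop_eq {n : ℕ} (σ : Equiv.Perm (Fin n)) : Asctop σ = ascF n (Desbot σ) (LRmax σ) := by
  rw [eq_iff_entry σ (asctop_sub σ)
    (show ascF n (Desbot σ) (LRmax σ) ⊆ Finset.Icc 1 n from Finset.filter_subset _ _)]
  intro i h1 h2
  rw [mem_asctop σ h1 h2]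
  simp only [ascF, Finset.mem_filter, Finset.mem_Icc, mem_desbot σ h1 h2]
  have hm := entry_mem σ h1 h2
  by_cases hi : i = 1
  · subst hi
    have : entry σ 1 ∈ LRmax σ ∧ ∀ l ∈ LRmax σ, entry σ 1 ≤ l := by
      constructor
      · rw [mem_lrmax σ h1 h2]; intro j _ _; omega
      · intro l hl
        obtain ⟨j, h3, h4, rfl⟩ := entry_surj σ (Finset.mem_Icc.1 (lrmax_sub σ hl)).1
          (Finset.mem_Icc.1 (lrmax_sub σ hl)).2
        rw [mem_lrmax σ h3 h4] at hl
        by_cases hj : j = 1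
        · rw [hj]
        · exact (hl 1 le_rfl (by omega)).le
    simp [this.1]
    exact fun _ _ => this.2
  · have h3 : ¬ (entry σ i ∈ LRmax σ ∧ ∀ l ∈ LRmax σ, entry σ i ≤ l) := by
      rintro ⟨h3, h4⟩
      rw [mem_lrmax σ h1 h2] at h3
      have h5 := h3 1 le_rfl (by omega)
      have h6 := h4 (entry σ 1) (by rw [mem_lrmax σ le_rfl (by omega)]; intro j _ _; omega)
      omega
    have h7 : entry σ i ≠ entry σ (i - 1) := fun e => by
      have := entry_inj σ h1 h2 (by omega) (by omega) e
      omega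
    simp only [h3, hm, not_false_eq_true, and_true, true_and]
    omega

theorem word_get {n : ℕ} (σ : Equiv.Perm (Fin n)) (j : ℕ) :
    (word σ)[j]? = if j = 0 then some 0 else if j ≤ n then some (entry σ j) else none := by
  cases j with
  | zero => simp [word]
  | succ j =>
    by_cases hj : j < n
    · simp [word, hj, entry_eq σ j hj, Nat.succ_le_of_lt hj]
    · simp [word, hj]

theorem word_typ {n : ℕ} (σ : Equiv.Perm (Fin n)) (T B L : Finset ℕ) {p s : List ℕ} {u : ℕ}
    (h : word σ = p ++ u :: s) (hu : u ≠ 0) : 1 ≤ p.length ∧ p.length ≤ n ∧ u = entry σ p.length ∧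
    (TypAt T B L p u s ↔ (u ∈ T ↔ u ∈ Destop σ) ∧ (u ∈ B ↔ u ∈ Desbot σ) ∧
      (u ∈ L ↔ u ∈ LRmax σ)) := by
  have hg := word_get σ
  rw [h] at hg
  have h0 := hg p.length
  simp only [List.getElem?_append_right le_rfl, Nat.sub_self, List.getElem?_cons_zero] at h0
  have h1 : 1 ≤ p.length := by
    by_contra hc
    rw [if_pos (by omega)] at h0
    simp at h0; exact hu h0
  rw [if_neg (by omega)] at h0
  have h2 : p.length ≤ n := by
    by_contra hc
    rw [if_neg hc] at h0
    simp at h0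
  rw [if_pos h2] at h0
  have h3 : u = entry σ p.length := by simpa using h0
  refine ⟨h1, h2, h3, ?_⟩
  have hs : s.head? = if p.length + 1 ≤ n then some (entry σ (p.length + 1)) else none := by
    have := hg (p.length + 1)
    rw [if_neg (by omega), List.getElem?_append_right (by omega)] at this
    simpa [List.head?_eq_getElem?] using this
  have hp : ∀ j, j < p.length → p[j]? = if j = 0 then some 0 else some (entry σ j) := by
    intro j hj
    have := hg j
    rw [List.getElem?_append_left hj] at this
    rw [this]
    simp [show j ≤ n by omega]
  have hl : p.getLast? = if p.length - 1 = 0 then some 0 else some (entry σ (p.length - 1)) := by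
    rw [List.getLast?_eq_getElem?, hp _ (by omega)]
  have e1 : (∃ z ∈ s.head?, z < u) ↔ u ∈ Destop σ := by
    rw [h3, mem_dtops σ h1 h2, hs]
    split_ifs with hc <;> simp [hc]
  have e2 : (∃ z ∈ p.getLast?, u < z) ↔ u ∈ Desbot σ := by
    rw [h3, mem_desbot σ h1 h2, hl]
    split_ifs with hc
    · simp; omega
    · have : 2 ≤ p.length := by omega
      simp [this]
  have e3 : (∀ l ∈ p, l < u) ↔ u ∈ LRmax σ := by
    rw [h3, mem_lrmax σ h1 h2]
    constructor
    · intro hh j hj1 hj2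
      apply hh
      have := hp j hj2
      rw [if_neg (by omega)] at this
      exact List.mem_of_getElem? this
    · intro hh l hlp
      obtain ⟨j, hj⟩ := List.mem_iff_getElem?.1 hlp
      have hjl : j < p.length := (List.getElem?_eq_some_iff.1 hj).1
      rw [hp j hjl] at hj
      split_ifs at hj with hc
      · have := entry_mem σ h1 h2
        simp at hj; omega
      · simp at hj; rw [← hj]; exact hh j (by omega) hjl
  unfold TypAt
  rw [e1, e2, e3]

theorem word_tail_nodup {n : ℕ} (σ : Equiv.Perm (Fin n)) :
    (List.ofFn (fun i : Fin n => (σ i : ℕ) + 1)).Nodup := by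
  rw [List.nodup_ofFn]
  intro i j h
  exact σ.injective (Fin.ext (Nat.succ_injective h))

theorem word_tail_mem {n : ℕ} (σ : Equiv.Perm (Fin n)) (u : ℕ) :
    u ∈ List.ofFn (fun i : Fin n => (σ i : ℕ) + 1) ↔ 0 < u ∧ u ≤ n := by
  rw [List.mem_ofFn]
  constructor
  · rintro ⟨i, rfl⟩
    have := (σ i).2
    exact ⟨by omega, by omega⟩
  · rintro ⟨h1, h2⟩
    obtain ⟨i, hi⟩ := σ.surjective ⟨u - 1, by omega⟩
    exact ⟨i, by simp [hi]; omega⟩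

theorem word_count {n : ℕ} (σ : Equiv.Perm (Fin n)) : (word σ).count 0 = 1 := by
  have : 0 ∉ List.ofFn (fun i : Fin n => (σ i : ℕ) + 1) := by rw [word_tail_mem]; omega
  simp [word, List.count_eq_zero.2 this]

theorem word_conf {n : ℕ} (σ : Equiv.Perm (Fin n)) {T B L : Finset ℕ} (hT : T ⊆ Finset.Icc 1 n)
    (hB : B ⊆ Finset.Icc 1 n) (hL : L ⊆ Finset.Icc 1 n) :
    Conf n 0 T B L (word σ) ↔ Destop σ = T ∧ Desbot σ = B ∧ LRmax σ = L := by
  rw [eq_iff_entry σ (dtops_sub σ) hT, eq_iff_entry σ (desbot_sub σ) hB,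
    eq_iff_entry σ (lrmax_sub σ) hL]
  constructor
  · intro h
    have key : ∀ i, 1 ≤ i → i ≤ n → (entry σ i ∈ T ↔ entry σ i ∈ Destop σ) ∧
        (entry σ i ∈ B ↔ entry σ i ∈ Desbot σ) ∧ (entry σ i ∈ L ↔ entry σ i ∈ LRmax σ) := by
      intro i h1 h2
      have hm := entry_mem σ h1 h2
      have : entry σ i ∈ word σ := by
        rw [word]
        exact List.mem_cons_of_mem _ ((word_tail_mem σ _).2 hm)
      obtain ⟨p, s, hw⟩ := List.append_of_mem this
      have := h.typ p _ s hw (by omega)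
      exact (word_typ σ T B L hw (by omega)).2.2.2.1 this
    exact ⟨fun i h1 h2 => (key i h1 h2).1, fun i h1 h2 => (key i h1 h2).2.1,
      fun i h1 h2 => (key i h1 h2).2.2⟩
  · rintro ⟨k1, k2, k3⟩
    refine ⟨⟨_, rfl⟩, ?_, ?_, ?_⟩
    · intro p s h
      have := word_count σ
      rw [h] at this
      simp at this
      omega
    · intro u hu
      have h0 : ¬ (0 = u) := fun h => hu h.symm
      simp only [word, List.count_cons, beq_iff_eq, h0, if_false, add_zero]
      rw [List.Nodup.count (word_tail_nodup σ)]
      simp only [word_tail_mem]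
    · intro p u s h hu
      obtain ⟨h1, h2, h3, h4⟩ := word_typ σ T B L h hu
      rw [h4, h3]
      exact ⟨k1 _ h1 h2, k2 _ h1 h2, k3 _ h1 h2⟩

theorem word_inj {n : ℕ} : Function.Injective (word (n := n)) := by
  intro σ τ h
  simp only [word, List.cons.injEq, true_and] at h
  have := List.ofFn_injective h
  ext i
  have := congrFun this i
  simpa using this

theorem word_surj {n : ℕ} {T B L : Finset ℕ} {w : List ℕ} (h : Conf n 0 T B L w)
    (h1 : w.count 0 = 1) : ∃ σ : Equiv.Perm (Fin n), word σ = w := by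
  obtain ⟨t, rfl⟩ := h.head
  have h0 : 0 ∉ t := by
    exact List.count_eq_zero.1 (by simpa using h1)
  have hperm : t.Perm (List.ofFn (fun i : Fin n => ((1 : Equiv.Perm (Fin n)) i : ℕ) + 1)) := by
    rw [List.perm_iff_count]
    intro u
    rw [List.Nodup.count (word_tail_nodup _)]
    simp only [word_tail_mem]
    by_cases hu : u = 0
    · subst hu; simp [List.count_eq_zero.2 h0]
    · have := h.cnt u hu
      rw [List.count_cons_of_ne (by omega)] at this
      exact this
  have hlen : t.length = n := by simpa using hperm.length_eq
  have hnd : t.Nodup := hperm.nodup_iff.2 (word_tail_nodup _)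
  have hmem : ∀ u ∈ t, 0 < u ∧ u ≤ n := fun u hu => (word_tail_mem 1 u).1 (hperm.mem_iff.1 hu)
  have hb : ∀ i : Fin n, 0 < t[i.1]'(by omega) ∧ t[i.1]'(by omega) ≤ n :=
    fun i => hmem _ (List.getElem_mem _)
  let f : Fin n → Fin n := fun i => ⟨t[i.1]'(by omega) - 1, by have := hb i; omega⟩
  have hf : Function.Injective f := by
    intro i j hij
    have h2 : t[i.1]'(by omega) - 1 = t[j.1]'(by omega) - 1 := congrArg Fin.val hij
    have := hb i
    have := hb j
    have h3 : t[i.1]'(by omega) = t[j.1]'(by omega) := by omega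
    exact Fin.ext ((List.Nodup.getElem_inj_iff hnd).1 h3)
  refine ⟨Equiv.ofBijective f (Finite.injective_iff_bijective.1 hf), ?_⟩
  simp only [word, List.cons.injEq, true_and]
  apply List.ext_getElem
  · simp [hlen]
  · intro i hi1 hi2
    have := hb ⟨i, by omega⟩
    simp [f] at this ⊢
    omega

theorem sub_word {n : ℕ} (σ : Equiv.Perm (Fin n)) {a b c d : ℕ} (ha : a ≠ 0)  :
    [a, b, c, d].Sublist (word σ) ↔ ∃ f : Fin 4 → Fin n, StrictMono f ∧
      a = σ (f 0) + 1 ∧ b = σ (f 1) + 1 ∧ c = σ (f 2) + 1 ∧ d = σ (f 3) + 1 := by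
  constructor
  · intro h
    have h := drop_u h (by simpa using ha)
    rw [List.sublist_iff_exists_fin_orderEmbedding_get_eq] at h
    obtain ⟨f, hf⟩ := h
    refine ⟨fun i => Fin.cast (by simp) (f i), ?_, ?_, ?_, ?_, ?_⟩
    · intro i j hij
      have := f.strictMono hij
      simpa using this
    · have := hf 0
      simp at this
      exact this
    · have := hf 1
      simp at this
      exact this
    · have := hf 2
      simp at this
      exact this
    · have := hf 3
      simp at this
      exact this
  · rintro ⟨f, hf, rfl, rfl, rfl, rfl⟩
    refine List.Sublist.cons _ ?_
    rw [List.sublist_iff_exists_fin_orderEmbedding_get_eq]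
    refine ⟨OrderEmbedding.ofStrictMono (fun i : Fin 4 => Fin.cast (by simp) (f i)) ?_, ?_⟩
    · intro i j hij
      have := hf hij
      simpa using this
    · intro i
      fin_cases i <;> simp <;> rfl

theorem avoid1 {n : ℕ} (σ : Equiv.Perm (Fin n)) :
    AvoidsPat (![2, 0, 3, 1] : Fin 4 → Fin 4) σ ↔ Av1 (word σ) := by
  constructor
  · intro h a b c d hs h1 h2 h3
    obtain ⟨f, hf, rfl, rfl, rfl, rfl⟩ := (sub_word σ (by omega)).1 hs
    apply h
    refine ⟨f, hf, ?_⟩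
    have hne : (σ (f 3) : ℕ) ≠ σ (f 0) := by
      intro e
      have := hf.injective (σ.injective (Fin.ext e))
      simp at this
    intro i j
    rw [Fin.lt_def (a := σ (f i))]
    fin_cases i <;> fin_cases j <;> simp [-Fin.val_fin_lt] <;> omega
  · rintro h ⟨f, hf, hp⟩
    have p1 := (hp 1 3).1 (by decide)
    have p2 := (hp 3 0).1 (by decide)
    have p3 := (hp 0 2).1 (by decide)
    rw [Fin.lt_def] at p1 p2 p3
    exact h _ _ _ _ ((sub_word σ (by omega)).2 ⟨f, hf, rfl, rfl, rfl, rfl⟩) (by omega) (by omega) (by omega)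

theorem avoid2 {n : ℕ} (σ : Equiv.Perm (Fin n)) :
    AvoidsPat (![2, 1, 3, 0] : Fin 4 → Fin 4) σ ↔ Av2 (word σ) := by
  constructor
  · intro h a b c d hs h1 h2 h3
    obtain ⟨f, hf, rfl, rfl, rfl, rfl⟩ := (sub_word σ (by omega)).1 hs
    apply h
    refine ⟨f, hf, ?_⟩
    have hne : (σ (f 1) : ℕ) ≠ σ (f 0) := by
      intro e
      have := hf.injective (σ.injective (Fin.ext e))
      simp at this
    intro i j
    rw [Fin.lt_def (a := σ (f i))]
    fin_cases i <;> fin_cases j <;> simp [-Fin.val_fin_lt] <;> omega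
  · rintro h ⟨f, hf, hp⟩
    have p1 := (hp 3 1).1 (by decide)
    have p2 := (hp 1 0).1 (by decide)
    have p3 := (hp 0 2).1 (by decide)
    rw [Fin.lt_def] at p1 p2 p3
    exact h _ _ _ _ ((sub_word σ (by omega)).2 ⟨f, hf, rfl, rfl, rfl, rfl⟩) (by omega) (by omega) (by omega)

theorem toWord {n : ℕ} {T B L : Finset ℕ} (hT : T ⊆ Finset.Icc 1 n)
    (hB : B ⊆ Finset.Icc 1 n) (hL : L ⊆ Finset.Icc 1 n) {Av : List ℕ → Prop}
    {Q : Equiv.Perm (Fin n) → Prop} (hQ : ∀ σ, Q σ ↔ Av (word σ)) :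
    Nonempty ({σ : Equiv.Perm (Fin n) // Q σ ∧ Destop σ = T ∧ Desbot σ = B ∧ LRmax σ = L} ≃
      {w : List ℕ // (Av w ∧ Conf n 0 T B L w) ∧ w.count 0 = 1}) := by
  refine ⟨Equiv.ofBijective (fun σ => ⟨word σ.1, ⟨(hQ _).1 σ.2.1, (word_conf σ.1 hT hB hL).2 σ.2.2⟩,
    word_count σ.1⟩) ⟨?_, ?_⟩⟩
  · intro σ τ h
    exact Subtype.ext (word_inj (congrArg Subtype.val h))
  · rintro ⟨w, ⟨h1, h2⟩, h3⟩
    obtain ⟨σ, rfl⟩ := word_surj h2 h3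
    exact ⟨⟨σ, (hQ _).2 h1, (word_conf σ hT hB hL).1 h2⟩, rfl⟩

theorem cond_iff {n : ℕ} (σ : Equiv.Perm (Fin n)) (Q : Prop) (T B A P L : Finset ℕ) :
    (Q ∧ Destop σ = T ∧ Desbot σ = B ∧ Asctop σ = A ∧ Peak σ = P ∧ LRmax σ = L) ↔
      (ascF n B L = A ∧ T ∩ ascF n B L = P) ∧
        (Q ∧ Destop σ = T ∧ Desbot σ = B ∧ LRmax σ = L) := by
  rw [Peak, asctop_eq]
  constructor
  · rintro ⟨q, rfl, rfl, rfl, rfl, rfl⟩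
    exact ⟨⟨rfl, rfl⟩, q, rfl, rfl, rfl⟩
  · rintro ⟨⟨rfl, rfl⟩, q, rfl, rfl, rfl⟩
    exact ⟨q, rfl, rfl, rfl, rfl, rfl⟩

end W

/-- The patterns 3142 and 3241 are
`(Destop, Desbot, Asctop, Peak, LRmax)`-Wilf equivalent. -/
theorem wilf_3142_3241 (n : ℕ) (T B A P L : Finset ℕ)
    (hT : T ⊆ Finset.Icc 1 n) (hB : B ⊆ Finset.Icc 1 n) (hA : A ⊆ Finset.Icc 1 n)
    (hP : P ⊆ Finset.Icc 1 n) (hL : L ⊆ Finset.Icc 1 n) :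
    ((Finset.univ : Finset (Equiv.Perm (Fin n))).filter
        (fun σ => AvoidsPat (![2, 0, 3, 1] : Fin 4 → Fin 4) σ ∧ Destop σ = T ∧
          Desbot σ = B ∧ Asctop σ = A ∧ Peak σ = P ∧ LRmax σ = L)).card =
      ((Finset.univ : Finset (Equiv.Perm (Fin n))).filter
        (fun σ => AvoidsPat (![2, 1, 3, 0] : Fin 4 → Fin 4) σ ∧ Destop σ = T ∧
          Desbot σ = B ∧ Asctop σ = A ∧ Peak σ = P ∧ LRmax σ = L)).card := by
  obtain ⟨e1⟩ := W.toWord hT hB hL (Av := W.Av1) W.avoid1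
  obtain ⟨e2⟩ := W.toWord hT hB hL (Av := W.Av2) W.avoid2
  obtain ⟨e⟩ := W.final_equiv W.spec1 W.spec2 n T B L
  simp only [W.cond_iff]
  by_cases hc : W.ascF n B L = A ∧ T ∩ W.ascF n B L = P
  · simp only [eq_true hc, true_and]
    rw [← Fintype.card_subtype, ← Fintype.card_subtype]
    exact Fintype.card_congr ((e1.trans e).trans e2.symm)
  · simp only [eq_false hc, false_and]
end
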